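/- arXiv:1303.2967 — 4 statements merged into one kernel-verified Lean document; each statement's English description precedes it below -/
import Mathlib

section
/- Let S and E be sets of n×n real orthogonal matrices such that the subgroup of the orthogonal group O(n) generated by S equals the subgroup generated by E. Then the topological closure of S* (the submonoid generated by S, i.e. the set of all finite products of elements of S, including the identity) equals the topological closure of the subgroup ⟨E⟩ generated by E. In particular, Cl(S*) is a subgroup of O(n): it contains the identity and is closed under matrix multiplication and inversion. -/
open Matrix in
theorem Matrix.isCompact_orthogonalGroup (n : Type*) [Fintype n] [DecidableEq n] :
    IsCompact (orthogonalGroup n ℝ : Set (Matrix n n ℝ)) := by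
  have hbox : IsCompact {A : Matrix n n ℝ | ∀ i, A i ∈ {v : n → ℝ | ∀ j, v j ∈ Set.Icc (-1) 1}} :=
    isCompact_pi_infinite fun _ => isCompact_pi_infinite fun _ => isCompact_Icc
  refine hbox.of_isClosed_subset ?_ fun A hA i j => ?_
  · have hclosed : IsClosed {A : Matrix n n ℝ | A * star A = 1} :=
      isClosed_eq (by fun_prop) continuous_const
    convert hclosed using 1
    ext A
    exact mem_orthogonalGroup_iff n ℝ
  · exact abs_le.mp (entry_norm_bound_of_unitary hA i j)

/-- If `S` and `E` are sets of orthogonal matrices generating the same subgroup of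
`O(n)`, then the closure of the submonoid `S*` generated by `S` equals the closure of the
subgroup `⟨E⟩` generated by `E`; in particular this closure contains the identity and is closed
under matrix multiplication and inversion. -/
theorem closure_submonoid_eq_closure_subgroup {n : ℕ}
    (S E : Set (Matrix.orthogonalGroup (Fin n) ℝ))
    (hSE : Subgroup.closure S = Subgroup.closure E) :
    closure (Subtype.val '' (Submonoid.closure S : Set (Matrix.orthogonalGroup (Fin n) ℝ)))
        = closure (Subtype.val '' (Subgroup.closure E : Set (Matrix.orthogonalGroup (Fin n) ℝ))) ∧
      (1 : Matrix (Fin n) (Fin n) ℝ) ∈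
        closure (Subtype.val '' (Submonoid.closure S : Set (Matrix.orthogonalGroup (Fin n) ℝ))) ∧
      (∀ M ∈ closure (Subtype.val ''
            (Submonoid.closure S : Set (Matrix.orthogonalGroup (Fin n) ℝ))),
        ∀ N ∈ closure (Subtype.val ''
            (Submonoid.closure S : Set (Matrix.orthogonalGroup (Fin n) ℝ))),
          M * N ∈ closure (Subtype.val ''
            (Submonoid.closure S : Set (Matrix.orthogonalGroup (Fin n) ℝ)))) ∧
      (∀ M ∈ closure (Subtype.val ''
            (Submonoid.closure S : Set (Matrix.orthogonalGroup (Fin n) ℝ))),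
        ∃ N ∈ closure (Subtype.val ''
            (Submonoid.closure S : Set (Matrix.orthogonalGroup (Fin n) ℝ))),
          M * N = 1 ∧ N * M = 1) := by
  have hcompact := Matrix.isCompact_orthogonalGroup (Fin n)
  have : CompactSpace (Matrix.orthogonalGroup (Fin n) ℝ) := isCompact_iff_compactSpace.mp hcompact
  have : IsTopologicalGroup (Matrix.orthogonalGroup (Fin n) ℝ) :=
    inferInstanceAs (IsTopologicalGroup (unitary (Matrix (Fin n) (Fin n) ℝ)))
  have closure_image (s : Set (Matrix.orthogonalGroup (Fin n) ℝ)) :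
      closure (Subtype.val '' s) = Subtype.val '' closure s :=
    hcompact.isClosed.isClosedEmbedding_subtypeVal.closure_image_eq s
  have closure_eq : closure (Submonoid.closure S : Set (Matrix.orthogonalGroup (Fin n) ℝ)) =
      (Subgroup.closure E).topologicalClosure := by
    rw [closure_submonoidClosure_eq_closure_subgroupClosure, hSE, Subgroup.topologicalClosure_coe]
  simp only [closure_image, closure_eq, ← Subgroup.topologicalClosure_coe]
  refine ⟨trivial, ⟨1, one_mem _, rfl⟩, ?_, ?_⟩
  · rintro _ ⟨g, hg, rfl⟩ _ ⟨h, hh, rfl⟩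
    exact ⟨g * h, mul_mem hg hh, rfl⟩
  · rintro _ ⟨g, hg, rfl⟩
    exact ⟨_, ⟨g⁻¹, inv_mem hg, rfl⟩, congrArg Subtype.val (mul_inv_cancel g),
      congrArg Subtype.val (inv_mul_cancel g)⟩
end

section
/- Let E be a set of n×n real orthogonal matrices and let G = Cl(⟨E⟩) be the topological closure of the subgroup generated by E. Then G equals the set of all n×n real matrices M such that p(M) = 0 for every real polynomial p in the n² matrix entries satisfying both p(I) = 0 and the identity p(eX) = p(X) for all e ∈ E (that is, for every e ∈ E, the polynomial functions X ↦ p(eX) and X ↦ p(X) coincide on all n×n real matrices). -/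
/-- Evaluation of a real polynomial in the `n²` matrix entries at a matrix. -/
noncomputable def matEval {ι : Type} [Fintype ι] (M : Matrix ι ι ℝ)
    (p : MvPolynomial (ι × ι) ℝ) : ℝ :=
  MvPolynomial.eval (fun ij => M ij.1 ij.2) p

/-- Disjoint compact sets of `ℝ^σ` can be separated by a polynomial. -/
theorem MvPolynomial.exists_eval_lt_of_disjoint_isCompact {σ : Type*} [Finite σ]
    {s t : Set (σ → ℝ)} (hs : IsCompact s) (ht : IsCompact t) (hst : Disjoint s t) :
    ∃ q : MvPolynomial σ ℝ, ∀ x ∈ s, ∀ y ∈ t,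
      MvPolynomial.eval x q < 1 / 2 ∧ 1 / 2 < MvPolynomial.eval y q := by
  have := Fintype.ofFinite σ
  obtain ⟨f, hf0, hf1, -⟩ := exists_continuous_zero_one_of_isClosed hs.isClosed ht.isClosed hst
  let coord : σ → C(σ → ℝ, ℝ) := fun i => ⟨fun x => x i, continuous_apply i⟩
  obtain ⟨_, ⟨q, rfl⟩, hq⟩ :=
    ContinuousMap.exists_mem_subalgebra_near_continuous_of_isCompact_of_separatesPoints
      (A := (MvPolynomial.aeval coord : MvPolynomial σ ℝ →ₐ[ℝ] C(σ → ℝ, ℝ)).range)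
      (fun x y hxy => by
        obtain ⟨i, hi⟩ := Function.ne_iff.mp hxy
        exact ⟨_, ⟨coord i, ⟨MvPolynomial.X i, by simp⟩, rfl⟩, hi⟩)
      f (hs.union ht) (ε := 1 / 2) (by norm_num)
  have heval : ∀ x, MvPolynomial.aeval coord q x = MvPolynomial.eval x q := fun x => by
    clear hq
    induction q using MvPolynomial.induction_on with
    | C a => simp
    | add p q hp hq => simp_all
    | mul_X p i hp => simp_all [coord]
  refine ⟨q, fun x hx y hy => ⟨?_, ?_⟩⟩
  · have h := hq x (Or.inl hx)
    have h0 : f x = 0 := hf0 hx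
    simp only [AlgHom.toRingHom_eq_coe, RingHom.coe_coe, heval, h0, Real.norm_eq_abs] at h
    linarith [(abs_lt.mp h).2]
  · have h := hq y (Or.inr hy)
    have h1 : f y = 1 := hf1 hy
    simp only [AlgHom.toRingHom_eq_coe, RingHom.coe_coe, heval, h1, Real.norm_eq_abs] at h
    linarith [(abs_lt.mp h).1]

theorem continuous_matEval {ι : Type} [Fintype ι] (p : MvPolynomial (ι × ι) ℝ) :
    Continuous fun M : Matrix ι ι ℝ => matEval M p :=
  (MvPolynomial.continuous_eval p).comp (by fun_prop)

/-- The polynomial function `(A, X) ↦ q (A * X)` is a finite sum of products of a polynomial in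
`A` and a monomial in `X`. -/
theorem exists_matEval_mul_eq_sum {ι : Type} [Fintype ι] (q : MvPolynomial (ι × ι) ℝ) :
    ∃ (s : Finset (ι × ι →₀ ℕ)) (c : (ι × ι →₀ ℕ) → MvPolynomial (ι × ι) ℝ),
      ∀ A X : Matrix ι ι ℝ, matEval (A * X) q =
        ∑ d ∈ s, matEval A (c d) * ∏ ij, X ij.1 ij.2 ^ d ij := by
  let Q : MvPolynomial (ι × ι) (MvPolynomial (ι × ι) ℝ) :=
    MvPolynomial.aeval (fun ij => ∑ k, MvPolynomial.C (MvPolynomial.X (ij.1, k)) *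
      MvPolynomial.X (k, ij.2)) q
  refine ⟨Q.support, fun d => Q.coeff d, fun A X => ?_⟩
  have h := MvPolynomial.eval₂_eq' (MvPolynomial.eval fun ij : ι × ι => A ij.1 ij.2)
    (fun ij : ι × ι => X ij.1 ij.2) Q
  refine Eq.trans ?_ h
  simp only [Q, matEval]
  clear h Q
  induction q using MvPolynomial.induction_on with
  | C a => simp [MvPolynomial.algebraMap_apply]
  | add p q hp hq => simp_all
  | mul_X p i hp => simp_all [Matrix.mul_apply, MvPolynomial.eval₂_sum]

/-- The average of the translates `X ↦ q (φ g * X)` is again a polynomial function. -/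
theorem exists_matEval_eq_integral {ι Ω : Type} [Fintype ι] [TopologicalSpace Ω] [CompactSpace Ω]
    [MeasurableSpace Ω] [BorelSpace Ω] (μ : MeasureTheory.Measure Ω)
    [MeasureTheory.IsFiniteMeasure μ] {φ : Ω → Matrix ι ι ℝ} (hφ : Continuous φ)
    (q : MvPolynomial (ι × ι) ℝ) :
    ∃ p : MvPolynomial (ι × ι) ℝ, ∀ X : Matrix ι ι ℝ,
      matEval X p = ∫ g, matEval (φ g * X) q ∂μ := by
  obtain ⟨s, c, hsc⟩ := exists_matEval_mul_eq_sum q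
  refine ⟨∑ d ∈ s, MvPolynomial.monomial d (∫ g, matEval (φ g) (c d) ∂μ), fun X => ?_⟩
  simp only [hsc]
  rw [MeasureTheory.integral_finsetSum]
  · simp only [MeasureTheory.integral_mul_const]
    simp [matEval, MvPolynomial.eval_monomial, Finsupp.prod_fintype]
  · intro d _
    have hc := (continuous_matEval (c d)).comp hφ
    exact ((hc.integrable_of_hasCompactSupport (HasCompactSupport.of_compactSpace _)).mul_const _)

instance Matrix.compactSpace_orthogonalGroup {ι : Type*} [Fintype ι] [DecidableEq ι] :
    CompactSpace (Matrix.orthogonalGroup ι ℝ) := by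
  refine isCompact_iff_compactSpace.mp (IsCompact.of_isClosed_subset
    (isCompact_univ_pi fun _ : ι => isCompact_univ_pi fun _ : ι => isCompact_Icc (a := (-1 : ℝ))
      (b := 1)) isClosed_unitary fun U hU i _ j _ => ?_)
  exact abs_le.mp (entry_norm_bound_of_unitary (𝕜 := ℝ) hU i j)

/-- A closed subgroup `G` of the orthogonal group is separated from any matrix outside it by a
polynomial invariant under left translation by `G`. -/
theorem exists_invariant_matEval_ne {ι : Type} [Fintype ι] [DecidableEq ι]
    (G : Subgroup (Matrix.orthogonalGroup ι ℝ))
    (hG : IsClosed (G : Set (Matrix.orthogonalGroup ι ℝ))) {M : Matrix ι ι ℝ}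
    (hM : M ∉ Subtype.val '' (G : Set (Matrix.orthogonalGroup ι ℝ))) :
    ∃ p : MvPolynomial (ι × ι) ℝ,
      (∀ e ∈ G, ∀ X : Matrix ι ι ℝ, matEval ((e : Matrix ι ι ℝ) * X) p = matEval X p) ∧
      matEval 1 p ≠ matEval M p := by
  have : CompactSpace G := isCompact_iff_compactSpace.mp hG.isCompact
  let : MeasurableSpace G := borel G
  have : BorelSpace G := ⟨rfl⟩
  let μ : MeasureTheory.Measure G := MeasureTheory.Measure.haar
  let φ : G → Matrix ι ι ℝ := fun g => ((g⁻¹ : G) : Matrix.orthogonalGroup ι ℝ)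
  have hφ : Continuous φ :=
    continuous_subtype_val.comp (continuous_subtype_val.comp continuous_inv)
  let flat : Matrix ι ι ℝ → ι × ι → ℝ := fun A ij => A ij.1 ij.2
  have hflat : Continuous flat := by fun_prop
  have hflat_inj : Function.Injective flat := fun A B h => by
    ext i j
    exact congrFun h (i, j)
  have hcont : ∀ X, Continuous fun g => φ g * X := fun X => hφ.mul continuous_const
  obtain ⟨q, hq⟩ := MvPolynomial.exists_eval_lt_of_disjoint_isCompact
    (isCompact_range (hflat.comp (hcont 1))) (isCompact_range (hflat.comp (hcont M))) (by
      rw [Set.disjoint_left]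
      rintro _ ⟨g, rfl⟩ ⟨h, hgh⟩
      have hgh : φ h * M = φ g * 1 := hflat_inj hgh
      refine hM ⟨(h * g⁻¹ : G), (h * g⁻¹).2, ?_⟩
      have hinv : ((h : Matrix.orthogonalGroup ι ℝ) : Matrix ι ι ℝ) * φ h = 1 :=
        congrArg (fun a : G => ((a : Matrix.orthogonalGroup ι ℝ) : Matrix ι ι ℝ))
          (mul_inv_cancel h)
      calc (((h * g⁻¹ : G) : Matrix.orthogonalGroup ι ℝ) : Matrix ι ι ℝ)
          = ((h : Matrix.orthogonalGroup ι ℝ) : Matrix ι ι ℝ) * (φ g * 1) := by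
            rw [mul_one]; rfl
        _ = M := by rw [← hgh, ← mul_assoc, hinv, one_mul])
  have hint : ∀ X, MeasureTheory.Integrable (fun g => matEval (φ g * X) q) μ := fun X =>
    ((continuous_matEval q).comp (hcont X)).integrable_of_hasCompactSupport
      (HasCompactSupport.of_compactSpace _)
  obtain ⟨p, hp⟩ := exists_matEval_eq_integral μ hφ q
  refine ⟨p, fun e he X => ?_, ne_of_lt ?_⟩
  · rw [hp, hp, ← MeasureTheory.integral_mul_left_eq_self
      (fun g => matEval (φ g * ((e : Matrix ι ι ℝ) * X)) q) ⟨e, he⟩]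
    refine MeasureTheory.integral_congr_ae (Filter.Eventually.of_forall fun g => ?_)
    have h : φ (⟨e, he⟩ * g) * (e : Matrix ι ι ℝ) = φ g :=
      congrArg (fun a : G => ((a : Matrix.orthogonalGroup ι ℝ) : Matrix ι ι ℝ))
        (show (⟨e, he⟩ * g)⁻¹ * ⟨e, he⟩ = g⁻¹ by group)
    simp only [← mul_assoc, h]
  · have hlt : ∀ g, 0 < matEval (φ g * M) q - matEval (φ g * 1) q := fun g =>
      have h := hq _ ⟨g, rfl⟩ _ ⟨g, rfl⟩
      sub_pos.mpr (h.1.trans h.2)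
    rw [hp, hp, ← sub_pos, ← MeasureTheory.integral_sub (hint M) (hint 1)]
    exact (((continuous_matEval q).comp (hcont M)).sub
      ((continuous_matEval q).comp (hcont 1))).integral_pos_of_hasCompactSupport_nonneg_nonzero
        (HasCompactSupport.of_compactSpace _) (fun g => (hlt g).le) (hlt 1).ne.symm

/-- The closure of the subgroup generated by a set `E` of orthogonal matrices
equals the common zero set of all real polynomials `p` in the matrix entries with `p(I) = 0`
and `p(eX) = p(X)` for all `e ∈ E` and all matrices `X`. -/
theorem closure_subgroup_eq_zero_set {n : ℕ}
    (E : Set (Matrix.orthogonalGroup (Fin n) ℝ)) :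
    closure (Subtype.val '' (Subgroup.closure E : Set (Matrix.orthogonalGroup (Fin n) ℝ)))
      = {M : Matrix (Fin n) (Fin n) ℝ |
          ∀ p : MvPolynomial (Fin n × Fin n) ℝ,
            matEval (1 : Matrix (Fin n) (Fin n) ℝ) p = 0 →
            (∀ e ∈ E, ∀ X : Matrix (Fin n) (Fin n) ℝ,
              matEval ((e : Matrix (Fin n) (Fin n) ℝ) * X) p = matEval X p) →
            matEval M p = 0} := by
  apply Set.Subset.antisymm
  · refine closure_minimal ?_ ?_
    · rintro _ ⟨g, hg, rfl⟩ p hp hE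
      have hinv : ∀ X : Matrix (Fin n) (Fin n) ℝ,
          matEval ((g : Matrix (Fin n) (Fin n) ℝ) * X) p = matEval X p := by
        induction hg using Subgroup.closure_induction with
        | mem e he => exact hE e he
        | one => simp
        | mul a b _ _ ha hb =>
          intro X
          rw [Submonoid.coe_mul, mul_assoc, ha, hb]
        | inv a _ ha =>
          intro X
          have h : (a : Matrix (Fin n) (Fin n) ℝ) * (a⁻¹ : Matrix.orthogonalGroup (Fin n) ℝ) = 1 :=
            congrArg Subtype.val (mul_inv_cancel a)
          rw [← ha, ← mul_assoc, h, one_mul]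
      simpa [hp] using hinv 1
    · simp only [Set.ofPred_forall]
      exact isClosed_iInter fun p => isClosed_iInter fun _ => isClosed_iInter fun _ =>
        isClosed_eq (continuous_matEval p) continuous_const
  · intro M hM
    by_contra hMG
    obtain ⟨p, hinv, hne⟩ := exists_invariant_matEval_ne (Subgroup.closure E).topologicalClosure
      (Subgroup.isClosed_topologicalClosure _) (M := M) fun h =>
        hMG (image_closure_subset_closure_image continuous_subtype_val h)
    have hsub : ∀ X : Matrix (Fin n) (Fin n) ℝ,
        matEval X (p - MvPolynomial.C (matEval 1 p)) = matEval X p - matEval 1 p := fun X => by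
      simp [matEval]
    refine hne (sub_eq_zero.mp ((hsub M).symm.trans (hM _ (by simp [hsub]) ?_))).symm
    intro e he X
    rw [hsub, hsub, hinv e (Subgroup.le_topologicalClosure _ (Subgroup.subset_closure he))]
end

section
/- Let G be a context-free grammar with terminal alphabet Σ, nonterminal set V and axiom S, and let L = L(G) be the language of terminal words derivable from S. Let C_S = {(α, β) ∈ Σ* × Σ* : S ⇒* αSβ} and let L'(G) be the set of terminal words w such that some rule S → β of G has right-hand side β containing no occurrence of S and β derives w using only rules whose left-hand side is different from S and whose right-hand side contains no occurrence of S, together with the terminal words w with S → w a rule of G. Then L(G) = C_S ⋄ L'(G) = {αuβ : (α, β) ∈ C_S and u ∈ L'(G)}. -/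
/-- One rewriting step of a context-free grammar using only rules whose left-hand side is not
the axiom and whose right-hand side contains no occurrence of the axiom. -/
def ProducesRestricted {T : Type} (g : ContextFreeGrammar T)
    (u v : List (Symbol T g.NT)) : Prop :=
  ∃ r ∈ g.rules, r.input ≠ g.initial ∧ Symbol.nonterminal g.initial ∉ r.output ∧ r.Rewrites u v

/-- Derivation using only rules whose left-hand side is not the axiom and whose right-hand side
contains no occurrence of the axiom. -/
def DerivesRestricted {T : Type} (g : ContextFreeGrammar T) :
    List (Symbol T g.NT) → List (Symbol T g.NT) → Prop :=
  Relation.ReflTransGen (ProducesRestricted g)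

/-- The terminal contexts `C_S = {(α, β) : S ⇒* α S β}` of the axiom `S`. -/
def terminalContexts {T : Type} (g : ContextFreeGrammar T) : Set (List T × List T) :=
  {ab | g.Derives [Symbol.nonterminal g.initial]
    (ab.1.map Symbol.terminal ++ [Symbol.nonterminal g.initial] ++ ab.2.map Symbol.terminal)}

/-- The language `L'(G)`: terminal words derivable from the right-hand side of an `S`-rule
containing no `S`, using only rules whose left-hand side is not `S` and whose right-hand side
contains no `S`, together with the terminal words `w` with `S → w` a rule of `G`. -/
def LPrime {T : Type} (g : ContextFreeGrammar T) : Set (List T) :=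
  {w | (∃ r ∈ g.rules, r.input = g.initial ∧ Symbol.nonterminal g.initial ∉ r.output ∧
      DerivesRestricted g r.output (w.map Symbol.terminal)) ∨
    (∃ r ∈ g.rules, r.input = g.initial ∧ r.output = w.map Symbol.terminal)}

theorem ContextFreeRule.Rewrites.append_split {T N : Type*} {r : ContextFreeRule T N}
    {a b v : List (Symbol T N)} (h : r.Rewrites (a ++ b) v) :
    (∃ a', r.Rewrites a a' ∧ v = a' ++ b) ∨ (∃ b', r.Rewrites b b' ∧ v = a ++ b') := by
  induction a generalizing v with
  | nil => exact Or.inr ⟨v, h, rfl⟩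
  | cons x a ih =>
    rw [List.cons_append] at h
    cases h with
    | head => exact Or.inl ⟨r.output ++ a, .head a, by simp⟩
    | cons _ h =>
      rcases ih h with ⟨a', ha, rfl⟩ | ⟨b', hb, rfl⟩
      · exact Or.inl ⟨x :: a', .cons x ha, rfl⟩
      · exact Or.inr ⟨b', hb, rfl⟩

theorem ProducesRestricted.produces {T : Type} {g : ContextFreeGrammar T}
    {u v : List (Symbol T g.NT)} (h : ProducesRestricted g u v) : g.Produces u v := by
  obtain ⟨r, hr, -, -, h⟩ := h
  exact ⟨r, hr, h⟩

theorem DerivesRestricted.derives {T : Type} {g : ContextFreeGrammar T}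
    {u v : List (Symbol T g.NT)} (h : DerivesRestricted g u v) : g.Derives u v :=
  Relation.ReflTransGen.mono (fun _ _ => ProducesRestricted.produces) _ _ h

theorem DerivesRestricted.append_split {T : Type} {g : ContextFreeGrammar T}
    {a b v : List (Symbol T g.NT)} (h : DerivesRestricted g (a ++ b) v) :
    ∃ a' b', DerivesRestricted g a a' ∧ DerivesRestricted g b b' ∧ v = a' ++ b' := by
  induction h with
  | refl => exact ⟨a, b, .refl, .refl, rfl⟩
  | tail _ hstep ih =>
    obtain ⟨a', b', ha, hb, rfl⟩ := ih
    obtain ⟨r, hr, hne, hout, hrw⟩ := hstep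
    rcases hrw.append_split with ⟨a'', h, rfl⟩ | ⟨b'', h, rfl⟩
    · exact ⟨a'', b', ha.tail ⟨r, hr, hne, hout, h⟩, hb, rfl⟩
    · exact ⟨a', b'', ha, hb.tail ⟨r, hr, hne, hout, h⟩, rfl⟩

/-- A derivation of a terminal word either never involves the axiom, or can be rearranged so that
the last occurrence of the axiom to be rewritten is surrounded by terminals only. -/
theorem derivesRestricted_or_exists_context {T : Type} {g : ContextFreeGrammar T}
    {x : List (Symbol T g.NT)} {w : List T} (h : g.Derives x (w.map Symbol.terminal)) :
    (Symbol.nonterminal g.initial ∉ x ∧ DerivesRestricted g x (w.map Symbol.terminal)) ∨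
    ∃ α β u, g.Derives x
        (α.map Symbol.terminal ++ [Symbol.nonterminal g.initial] ++ β.map Symbol.terminal) ∧
      u ∈ LPrime g ∧ w = α ++ u ++ β := by
  induction h using Relation.ReflTransGen.head_induction_on with
  | refl => exact Or.inl ⟨by simp, .refl⟩
  | head hstep _ ih =>
    rcases ih with ⟨hmem, hder⟩ | ⟨α, β, u, hder, hu, hw⟩
    · obtain ⟨r, hr, hrw⟩ := hstep
      obtain ⟨p, q, rfl, rfl⟩ := hrw.exists_parts
      simp only [List.mem_append, not_or] at hmem
      obtain ⟨⟨hp, hout⟩, hq⟩ := hmem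
      by_cases hin : r.input = g.initial
      · obtain ⟨v, q', hv, hq', hvq⟩ := hder.append_split
        obtain ⟨p', o', hp', ho', rfl⟩ := hv.append_split
        obtain ⟨v', β, rfl, hv', rfl⟩ := List.map_eq_append_iff.1 hvq
        obtain ⟨α, u, rfl, rfl, rfl⟩ := List.map_eq_append_iff.1 hv'
        refine Or.inr ⟨α, β, u, ?_, Or.inl ⟨r, hr, hin, hout, ho'⟩, rfl⟩
        rw [hin]
        exact ((hp'.derives.append_right _).append_right _).trans (hq'.derives.append_left _)
      · refine Or.inl ⟨?_, .head ⟨r, hr, hin, hout, hrw⟩ hder⟩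
        simp [hp, hq, Ne.symm hin]
    · exact Or.inr ⟨α, β, u, hstep.trans_derives hder, hu, hw⟩

theorem derives_of_mem_LPrime {T : Type} {g : ContextFreeGrammar T} {u : List T}
    (h : u ∈ LPrime g) :
    g.Derives [Symbol.nonterminal g.initial] (u.map Symbol.terminal) := by
  rcases h with ⟨r, hr, hin, -, hder⟩ | ⟨r, hr, hin, hout⟩
  · rw [← hin]
    exact ContextFreeGrammar.Produces.trans_derives ⟨r, hr, .input_output⟩ hder.derives
  · rw [← hin, ← hout]
    exact ContextFreeGrammar.Produces.single ⟨r, hr, .input_output⟩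

/-- `L(G) = C_S ⋄ L'(G)`. -/
theorem language_eq_contexts_sandwich_LPrime {T : Type} (g : ContextFreeGrammar T) :
    g.language = {w : List T | ∃ α β u,
      (α, β) ∈ terminalContexts g ∧ u ∈ LPrime g ∧ w = α ++ u ++ β} := by
  ext w
  constructor
  · intro h
    rcases derivesRestricted_or_exists_context h with ⟨hmem, -⟩ | h
    · simp at hmem
    · exact h
  · rintro ⟨α, β, u, hctx, hu, rfl⟩
    rw [ContextFreeGrammar.mem_language_iff, List.map_append, List.map_append]
    exact ContextFreeGrammar.Derives.trans hctx
      (((derives_of_mem_LPrime hu).append_left _).append_right _)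
end

section
/- Let Σ be a finite alphabet, let φ : Σ* → O(n) be a monoid morphism into the group of n×n real orthogonal matrices, fix words w₁, …, w_k ∈ Σ* and vectors v₀, v₁, …, v_p ∈ ℕ^k, and let R = {v₀ + λ₁v₁ + ⋯ + λ_p v_p : λ₁, …, λ_p ∈ ℕ} and L = {w₁^{n₁} w₂^{n₂} ⋯ w_k^{n_k} : (n₁, …, n_k) ∈ R}. Then the topological closure of φ(L) in the space of n×n real matrices is semialgebraic. -/
open Matrix

/-- A subset of `ℝ^σ` is semialgebraic if it is a finite union of sets of the form
`{x : p(x) = 0 ∧ q₁(x) > 0 ∧ … ∧ q_m(x) > 0}` for real polynomials `p, q₁, …, q_m`. -/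
def IsSemialgebraic {σ : Type} [Fintype σ] (A : Set (σ → ℝ)) : Prop :=
  ∃ (k : ℕ) (p : Fin k → MvPolynomial σ ℝ) (q : Fin k → Finset (MvPolynomial σ ℝ)),
    A = ⋃ i, {x | MvPolynomial.eval x (p i) = 0 ∧ ∀ r ∈ q i, 0 < MvPolynomial.eval x r}

/-- A set of matrices is semialgebraic if the corresponding set of entry-vectors is. -/
def MatSemialgebraic {ι : Type} [Fintype ι] (A : Set (Matrix ι ι ℝ)) : Prop :=
  IsSemialgebraic {x : ι × ι → ℝ | (Matrix.of fun i j => x (i, j)) ∈ A}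

/-- The position of `t` relative to `c` is the same as the position of `s` relative to `d`. -/
def SameSide (c t d s : ℝ) : Prop := (c < t ↔ d < s) ∧ (t < c ↔ s < d)

lemma SameSide.symm {c t d s : ℝ} (h : SameSide c t d s) : SameSide d s c t :=
  ⟨h.1.symm, h.2.symm⟩

lemma SameSide.trans {c t d s e r : ℝ} (h : SameSide c t d s) (h' : SameSide d s e r) :
    SameSide c t e r :=
  ⟨h.1.trans h'.1, h.2.trans h'.2⟩

lemma SameSide.eq_iff {c t d s : ℝ} (h : SameSide c t d s) : c = t ↔ d = s := by
  have h1 := h.1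
  have h2 := h.2
  constructor <;> rintro rfl <;> simp_all [le_antisymm_iff]

lemma sameSide_iff_cmp {c t d s : ℝ} : SameSide c t d s ↔ cmp c t = cmp d s := by
  constructor
  · intro h
    rcases lt_trichotomy c t with h1 | h1 | h1
    · rw [h1.cmp_eq_lt, (h.1.1 h1).cmp_eq_lt]
    · rw [cmp_eq_eq_iff _ _ |>.2 h1, cmp_eq_eq_iff _ _ |>.2 (h.eq_iff.1 h1)]
    · rw [h1.cmp_eq_gt, (h.2.1 h1).cmp_eq_gt]
  · intro h
    exact ⟨lt_iff_lt_of_cmp_eq_cmp h, lt_iff_lt_of_cmp_eq_cmp (cmp_eq_cmp_symm.1 h)⟩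

/-- The pairs in `f` form a partial order isomorphism. -/
def IsMatching (f : Finset (ℝ × ℝ)) : Prop :=
  ∀ p ∈ f, ∀ q ∈ f, SameSide p.1 q.1 p.2 q.2

/-- The pair `(t, s)` extends the matching `f`. -/
def Fits (f : Finset (ℝ × ℝ)) (t s : ℝ) : Prop := ∀ p ∈ f, SameSide p.1 t p.2 s

/-- The reversed matching. -/
def revMatching (f : Finset (ℝ × ℝ)) : Finset (ℝ × ℝ) := f.map (Equiv.prodComm ℝ ℝ).toEmbedding

lemma mem_revMatching {f : Finset (ℝ × ℝ)} {p : ℝ × ℝ} : p ∈ revMatching f ↔ (p.2, p.1) ∈ f := by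
  simp only [revMatching, Finset.mem_map_equiv]
  rfl

lemma IsMatching.rev {f : Finset (ℝ × ℝ)} (hf : IsMatching f) : IsMatching (revMatching f) :=
  fun _ hp _ hq => (hf _ (mem_revMatching.1 hp) _ (mem_revMatching.1 hq)).symm

lemma fits_rev {f : Finset (ℝ × ℝ)} {t s : ℝ} : Fits (revMatching f) s t ↔ Fits f t s :=
  ⟨fun h p hp => (h (p.2, p.1) (mem_revMatching.2 hp)).symm,
    fun h _ hp => (h _ (mem_revMatching.1 hp)).symm⟩

lemma IsMatching.exists_fits {f : Finset (ℝ × ℝ)} (hf : IsMatching f) (t : ℝ) :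
    ∃ s, Fits f t s := by
  obtain ⟨s, hs⟩ := Order.PartialIso.exists_across
    (⟨f, fun p hp q hq => sameSide_iff_cmp.1 (hf p hp q hq)⟩ : Order.PartialIso ℝ ℝ) t
  exact ⟨s, fun p hp => sameSide_iff_cmp.2 (hs p hp)⟩

lemma IsMatching.exists_fits' {f : Finset (ℝ × ℝ)} (hf : IsMatching f) (s : ℝ) :
    ∃ t, Fits f t s := by
  obtain ⟨t, ht⟩ := hf.rev.exists_fits s
  exact ⟨t, fits_rev.1 ht⟩

open Polynomial in
/-- An increasing polynomial which is nonpositive at `t` either vanishes to the right of `t` before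
reaching `F`, or is nonpositive at the next point of `F`. -/
lemma exists_root_ge (a : ℝ[X]) (F : Finset ℝ) (t : ℝ)
    (hpos : ∀ u, (∀ c ∈ F, SameSide c t c u) → 0 < a.derivative.eval u) (htF : t ∉ F)
    (ht : a.eval t ≤ 0) :
    (∃ u, t ≤ u ∧ a.eval u = 0 ∧ ∀ c ∈ F, SameSide c t c u) ∨
      ∃ c ∈ F, t < c ∧ (∀ c' ∈ F, t < c' → c ≤ c') ∧ a.eval c ≤ 0 := by
  have hlt : ∀ c ∈ F, c < t ∨ t < c := fun c hc => lt_or_gt_of_ne (fun h => htF (h ▸ hc))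
  rcases (F.filter (t < ·)).eq_empty_or_nonempty with hB | hB
  · left
    have hside : ∀ u, t ≤ u → ∀ c ∈ F, SameSide c t c u := by
      intro u hu c hc
      have : ¬ t < c := fun h => by
        have : c ∈ F.filter (t < ·) := by simp [hc, h]
        simp [hB] at this
      have := hlt c hc
      constructor <;> constructor <;> intro h <;> grind
    have hmono : StrictMonoOn (fun u => a.eval u) (Set.Ici t) := by
      apply strictMonoOn_of_deriv_pos (convex_Ici t) a.continuous.continuousOn
      intro u hu
      rw [interior_Ici] at hu
      rw [Polynomial.deriv]
      exact hpos u (hside u (le_of_lt hu))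
    have hdeg : 0 < a.degree := by
      by_contra hcon
      have h0 := hpos t (fun c _ => ⟨Iff.rfl, Iff.rfl⟩)
      rw [Polynomial.eq_C_of_degree_le_zero (not_lt.1 hcon)] at h0
      simp at h0
    obtain ⟨v, hv, hv0⟩ : ∃ v, t ≤ v ∧ 0 ≤ a.eval v := by
      by_cases hlc : 0 ≤ a.leadingCoeff
      · have := a.tendsto_atTop_of_leadingCoeff_nonneg hdeg hlc
        obtain ⟨v, h1, h2⟩ := ((this.eventually_ge_atTop 0).and
          (Filter.eventually_ge_atTop t)).exists
        exact ⟨v, h2, h1⟩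
      · exfalso
        have := a.tendsto_atBot_of_leadingCoeff_nonpos hdeg (le_of_not_ge hlc)
        obtain ⟨v, h1, h2⟩ := ((this.eventually_lt_atBot (a.eval t)).and
          (Filter.eventually_ge_atTop t)).exists
        have := hmono.monotoneOn (Set.mem_Ici.2 le_rfl) (Set.mem_Ici.2 h2) h2
        linarith
    obtain ⟨u, hu, hu0⟩ := intermediate_value_Icc hv a.continuous.continuousOn
      (Set.mem_Icc.2 ⟨ht, hv0⟩)
    exact ⟨u, hu.1, hu0, hside u hu.1⟩
  · set c := (F.filter (t < ·)).min' hB with hc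
    have hcm := (F.filter (t < ·)).min'_mem hB
    rw [← hc, Finset.mem_filter] at hcm
    have hmin : ∀ c' ∈ F, t < c' → c ≤ c' := fun c' h1 h2 =>
      Finset.min'_le _ _ (Finset.mem_filter.2 ⟨h1, h2⟩)
    by_cases hac : a.eval c ≤ 0
    · exact Or.inr ⟨c, hcm.1, hcm.2, hmin, hac⟩
    · left
      obtain ⟨u, hu, hu0⟩ := intermediate_value_Icc hcm.2.le a.continuous.continuousOn
        (Set.mem_Icc.2 ⟨ht, (not_le.1 hac).le⟩)
      simp only at hu0
      have huc : u ≠ c := fun h => hac (by rw [← h, hu0])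
      have huc' : u < c := lt_of_le_of_ne hu.2 huc
      refine ⟨u, hu.1, hu0, fun c' hc' => ?_⟩
      have h1 := hlt c' hc'
      have h2 := hmin c' hc'
      have h3 := hu.1
      constructor <;> constructor <;> intro h <;> grind

open Polynomial in
lemma exists_root_le (a : ℝ[X]) (F : Finset ℝ) (t : ℝ)
    (hpos : ∀ u, (∀ c ∈ F, SameSide c t c u) → 0 < a.derivative.eval u) (htF : t ∉ F)
    (ht : 0 ≤ a.eval t) :
    (∃ u, u ≤ t ∧ a.eval u = 0 ∧ ∀ c ∈ F, SameSide c t c u) ∨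
      ∃ c ∈ F, c < t ∧ (∀ c' ∈ F, c' < t → c' ≤ c) ∧ 0 ≤ a.eval c := by
  classical
  have hside : ∀ u : ℝ, (∀ c ∈ F.image Neg.neg, SameSide c (-t) c u) →
      ∀ c ∈ F, SameSide c t c (-u) := by
    intro u hu c hc
    obtain ⟨h1, h2⟩ := hu (-c) (Finset.mem_image_of_mem _ hc)
    constructor
    · rw [← neg_lt_neg_iff, h2, lt_neg]
    · rw [← neg_lt_neg_iff, h1, neg_lt]
  refine Or.elim (exists_root_ge (-(a.comp (-X))) (F.image Neg.neg) (-t) ?_ ?_ ?_) (fun h => ?_)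
    fun h => ?_
  rotate_left 3
  · obtain ⟨u, h1, h2, h3⟩ := h
    refine Or.inl ⟨-u, by linarith, by simpa using h2, hside u h3⟩
  · obtain ⟨c, hc, h1, h2, h3⟩ := h
    obtain ⟨d, hd, rfl⟩ := Finset.mem_image.1 hc
    refine Or.inr ⟨d, hd, by linarith, fun c' hc' hlt => ?_, by simpa using h3⟩
    have := h2 (-c') (Finset.mem_image_of_mem _ hc') (by linarith)
    linarith
  · intro u hu
    have := hpos (-u) (hside u hu)
    simpa [derivative_comp] using this
  · simpa using htF
  · simpa using ht

section matching

open Polynomial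

variable {f : Finset (ℝ × ℝ)} {t s : ℝ} {a b : ℝ[X]}

/-- If increasing polynomials `a`, `b` have matching signs at the points of `f`, but not at the
matching points `t`, `s`, then they have roots in the cells of `t` and `s`. -/
lemma exists_matching_roots_ge (hf : Fits f t s) (hne : ∀ p ∈ f, p.1 ≠ t)
    (ha : ∀ u, (∀ p ∈ f, SameSide p.1 t p.1 u) → 0 < a.derivative.eval u)
    (hb : ∀ u, (∀ p ∈ f, SameSide p.2 s p.2 u) → 0 < b.derivative.eval u)
    (hsgn : ∀ p ∈ f, SignType.sign (a.eval p.1) = SignType.sign (b.eval p.2))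
    (hf' : IsMatching f)
    (hat : a.eval t ≤ 0) (hbs : 0 ≤ b.eval s) :
    ∃ u, t ≤ u ∧ a.eval u = 0 ∧ ∀ p ∈ f, SameSide p.1 t p.1 u := by
  classical
  refine Or.elim (exists_root_ge a (f.image Prod.fst) t ?_ ?_ hat) (fun h => ?_) fun h => ?_
  rotate_left 2
  · obtain ⟨u, h1, h2, h3⟩ := h
    exact ⟨u, h1, h2, fun p hp => h3 _ (Finset.mem_image_of_mem _ hp)⟩
  · exfalso
    obtain ⟨c, hc, htc, hmin, hac⟩ := h
    obtain ⟨p, hp, rfl⟩ := Finset.mem_image.1 hc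
    have hbp : b.eval p.2 ≤ 0 := by
      have := hsgn p hp
      rw [← sign_nonpos_iff] at hac ⊢
      rwa [← this]
    have hsp : s < p.2 := (hf p hp).2.1 htc
    have hmono : StrictMonoOn (fun u => b.eval u) (Set.Icc s p.2) := by
      apply strictMonoOn_of_deriv_pos (convex_Icc _ _) b.continuous.continuousOn
      intro u hu
      rw [interior_Icc] at hu
      rw [Polynomial.deriv]
      refine hb u fun q hq => ?_
      have h1 := hf q hq
      have h2 := hne q hq
      have h3 : q.2 < s ∨ s < q.2 := by
        rcases lt_or_gt_of_ne h2 with h | h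
        · exact Or.inl (h1.1.1 h)
        · exact Or.inr (h1.2.1 h)
      have h4 : s < q.2 → p.2 ≤ q.2 := by
        intro h
        have h5 := hmin q.1 (Finset.mem_image_of_mem _ hq) (h1.2.2 h)
        by_contra h6
        exact absurd ((hf' q hq p hp).1.2 (not_le.1 h6)) (not_lt.2 h5)
      obtain ⟨h5, h6⟩ := hu
      constructor <;> constructor <;> intro h <;> grind
    have := hmono (Set.left_mem_Icc.2 hsp.le) (Set.right_mem_Icc.2 hsp.le) hsp
    simp only at this
    linarith
  · intro u hu
    exact ha u fun p hp => hu _ (Finset.mem_image_of_mem _ hp)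
  · intro h
    obtain ⟨p, hp, h⟩ := Finset.mem_image.1 h
    exact hne p hp h

lemma exists_matching_roots_le (hf : Fits f t s) (hne : ∀ p ∈ f, p.1 ≠ t)
    (ha : ∀ u, (∀ p ∈ f, SameSide p.1 t p.1 u) → 0 < a.derivative.eval u)
    (hb : ∀ u, (∀ p ∈ f, SameSide p.2 s p.2 u) → 0 < b.derivative.eval u)
    (hsgn : ∀ p ∈ f, SignType.sign (a.eval p.1) = SignType.sign (b.eval p.2))
    (hf' : IsMatching f)
    (hat : a.eval t ≤ 0) (hbs : 0 ≤ b.eval s) :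
    ∃ u, u ≤ s ∧ b.eval u = 0 ∧ ∀ p ∈ f, SameSide p.2 s p.2 u := by
  classical
  have hne' : ∀ p ∈ f, p.2 ≠ s := fun p hp h => hne p hp ((hf p hp).eq_iff.2 h)
  refine Or.elim (exists_root_le b (f.image Prod.snd) s ?_ ?_ hbs) (fun h => ?_) fun h => ?_
  rotate_left 2
  · obtain ⟨u, h1, h2, h3⟩ := h
    exact ⟨u, h1, h2, fun p hp => h3 _ (Finset.mem_image_of_mem _ hp)⟩
  · exfalso
    obtain ⟨c, hc, htc, hmin, hac⟩ := h
    obtain ⟨p, hp, rfl⟩ := Finset.mem_image.1 hc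
    have hbp : 0 ≤ a.eval p.1 := by
      have := hsgn p hp
      rw [← sign_nonneg_iff] at hac ⊢
      rwa [this]
    have hsp : p.1 < t := (hf p hp).1.2 htc
    have hmono : StrictMonoOn (fun u => a.eval u) (Set.Icc p.1 t) := by
      apply strictMonoOn_of_deriv_pos (convex_Icc _ _) a.continuous.continuousOn
      intro u hu
      rw [interior_Icc] at hu
      rw [Polynomial.deriv]
      refine ha u fun q hq => ?_
      have h1 := hf q hq
      have h3 : q.1 < t ∨ t < q.1 := lt_or_gt_of_ne (hne q hq)
      have h4 : q.1 < t → q.1 ≤ p.1 := by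
        intro h
        have h5 := hmin q.2 (Finset.mem_image_of_mem _ hq) (h1.1.1 h)
        by_contra h6
        exact absurd ((hf' q hq p hp).2.1 (not_le.1 h6)) (not_lt.2 h5)
      obtain ⟨h5, h6⟩ := hu
      constructor <;> constructor <;> intro h <;> grind
    have := hmono (Set.left_mem_Icc.2 hsp.le) (Set.right_mem_Icc.2 hsp.le) hsp
    simp only at this
    linarith
  · intro u hu
    exact hb u fun p hp => hu _ (Finset.mem_image_of_mem _ hp)
  · intro h
    obtain ⟨p, hp, h⟩ := Finset.mem_image.1 h
    exact hne' p hp h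

end matching

section elimination

open Polynomial

/-- If increasing polynomials `a`, `b` have matching signs at the points of `f`, then they have the
same sign at matching points whose position relative to the roots of `a` and `b` is the same. -/
lemma sign_eval_eq_of_increasing {f : Finset (ℝ × ℝ)} {t s : ℝ} {a b : ℝ[X]}
    (hf : Fits f t s) (hne : ∀ p ∈ f, p.1 ≠ t)
    (ha : ∀ u, (∀ p ∈ f, SameSide p.1 t p.1 u) → 0 < a.derivative.eval u)
    (hb : ∀ u, (∀ p ∈ f, SameSide p.2 s p.2 u) → 0 < b.derivative.eval u)
    (hsgn : ∀ p ∈ f, SignType.sign (a.eval p.1) = SignType.sign (b.eval p.2))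
    (hf' : IsMatching f)
    (hroots : ∀ u v, Fits f u v → a.eval u = 0 → b.eval v = 0 → SameSide u t v s) :
    SignType.sign (a.eval t) = SignType.sign (b.eval s) := by
  have key : ∀ u v, (∀ p ∈ f, SameSide p.1 t p.1 u) → (∀ p ∈ f, SameSide p.2 s p.2 v) →
      Fits f u v := fun u v hu hv p hp =>
    SameSide.trans (hu p hp).symm ((hf p hp).trans (hv p hp))
  by_cases h1 : a.eval t ≤ 0 ∧ 0 ≤ b.eval s
  · obtain ⟨u, hu, hau, hfu⟩ := exists_matching_roots_ge hf hne ha hb hsgn hf' h1.1 h1.2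
    obtain ⟨v, hv, hbv, hfv⟩ := exists_matching_roots_le hf hne ha hb hsgn hf' h1.1 h1.2
    have hs := hroots u v (key u v hfu hfv) hau hbv
    have hut : u = t := le_antisymm (not_lt.1 fun h => absurd (hs.2.1 h) (not_lt.2 hv)) hu
    have hvs : v = s := hs.eq_iff.1 hut
    rw [← hut, ← hvs, hau, hbv]
  · by_cases h2 : b.eval s ≤ 0 ∧ 0 ≤ a.eval t
    · have hne' : ∀ p ∈ revMatching f, p.1 ≠ s := fun p hp h =>
        hne _ (mem_revMatching.1 hp) ((hf _ (mem_revMatching.1 hp)).eq_iff.2 h)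
      have ha' : ∀ u, (∀ p ∈ revMatching f, SameSide p.2 t p.2 u) → 0 < a.derivative.eval u :=
        fun u hu => ha u fun p hp => hu (p.2, p.1) (mem_revMatching.2 hp)
      have hb' : ∀ u, (∀ p ∈ revMatching f, SameSide p.1 s p.1 u) → 0 < b.derivative.eval u :=
        fun u hu => hb u fun p hp => hu (p.2, p.1) (mem_revMatching.2 hp)
      have hsgn' : ∀ p ∈ revMatching f,
          SignType.sign (b.eval p.1) = SignType.sign (a.eval p.2) :=
        fun p hp => (hsgn _ (mem_revMatching.1 hp)).symm
      obtain ⟨v, hv, hbv, hfv⟩ :=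
        exists_matching_roots_ge (fits_rev.2 hf) hne' hb' ha' hsgn' hf'.rev h2.1 h2.2
      obtain ⟨u, hu, hau, hfu⟩ :=
        exists_matching_roots_le (fits_rev.2 hf) hne' hb' ha' hsgn' hf'.rev h2.1 h2.2
      have hs := hroots u v (key u v (fun p hp => hfu (p.2, p.1) (mem_revMatching.2 hp))
        fun p hp => hfv (p.2, p.1) (mem_revMatching.2 hp)) hau hbv
      have hut : u = t := le_antisymm hu (not_lt.1 fun h => absurd (hs.1.1 h) (not_lt.2 hv))
      have hvs : v = s := hs.eq_iff.1 hut
      rw [← hut, ← hvs, hau, hbv]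
    · rcases lt_trichotomy (a.eval t) 0 with h | h | h
      · rw [sign_neg h, sign_neg]
        grind
      · grind
      · rw [sign_pos h, sign_pos]
        grind

lemma sign_eval_eq_of_monotone {f : Finset (ℝ × ℝ)} {t s : ℝ} {a b : ℝ[X]}
    (hf : Fits f t s) (hne : ∀ p ∈ f, p.1 ≠ t) {ε : SignType} (hε : ε ≠ 0)
    (ha : ∀ u, (∀ p ∈ f, SameSide p.1 t p.1 u) → SignType.sign (a.derivative.eval u) = ε)
    (hb : ∀ u, (∀ p ∈ f, SameSide p.2 s p.2 u) → SignType.sign (b.derivative.eval u) = ε)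
    (hsgn : ∀ p ∈ f, SignType.sign (a.eval p.1) = SignType.sign (b.eval p.2))
    (hf' : IsMatching f)
    (hroots : ∀ u v, Fits f u v → a.eval u = 0 → b.eval v = 0 → SameSide u t v s) :
    SignType.sign (a.eval t) = SignType.sign (b.eval s) := by
  cases ε with
  | zero => exact absurd rfl hε
  | pos =>
    exact sign_eval_eq_of_increasing hf hne (fun u hu => sign_eq_one_iff.1 (ha u hu))
      (fun u hu => sign_eq_one_iff.1 (hb u hu)) hsgn hf' hroots
  | neg =>
    have := sign_eval_eq_of_increasing (a := -a) (b := -b) hf hne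
      (fun u hu => by simpa using sign_eq_neg_one_iff.1 (ha u hu))
      (fun u hu => by simpa using sign_eq_neg_one_iff.1 (hb u hu))
      (fun p hp => by simpa [Left.sign_neg] using hsgn p hp) hf'
      (fun u v h h1 h2 => hroots u v h (by simpa using h1) (by simpa using h2))
    simpa [Left.sign_neg] using this

/-- Pseudo-division of `q` by `g`, where `g` has formal leading coefficient `g.coeff d`. -/
lemma exists_pseudo_remainder {R : Type*} [CommRing R] (g q : R[X]) {d : ℕ}
    (hg : g.natDegree ≤ d) (hd : 1 ≤ d) :
    ∃ (k : ℕ) (s r : R[X]), C (g.coeff d) ^ k * q = g * s + r ∧ r.natDegree < d := by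
  induction hN : q.natDegree using Nat.strong_induction_on generalizing q with
  | _ N ih =>
    rcases lt_or_ge q.natDegree d with hlt | hge
    · exact ⟨0, 0, q, by simp, hlt⟩
    · set q₁ := C (g.coeff d) * q - C (q.coeff N) * X ^ (N - d) * g with hq₁
      have hdeg : q₁.natDegree < N := by
        have hN1 : 1 ≤ N := by omega
        rw [Nat.lt_iff_le_pred hN1, natDegree_le_iff_coeff_eq_zero]
        intro i hi
        have hi' : N ≤ i := by omega
        rw [hq₁, coeff_sub, mul_assoc, coeff_C_mul, coeff_C_mul, coeff_X_pow_mul',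
          if_pos (by omega)]
        rcases hi'.eq_or_lt with rfl | hlt
        · rw [show N - (N - d) = d by omega]
          ring
        · rw [coeff_eq_zero_of_natDegree_lt (by omega : q.natDegree < i),
            coeff_eq_zero_of_natDegree_lt (by omega : g.natDegree < i - (N - d))]
          simp
      obtain ⟨k, s, r, h, hr⟩ := ih _ hdeg q₁ rfl
      refine ⟨k + 1, s + C (g.coeff d) ^ k * (C (q.coeff N) * X ^ (N - d)), r, ?_, hr⟩
      have : C (g.coeff d) ^ k * q₁ = C (g.coeff d) ^ (k + 1) * q
          - C (g.coeff d) ^ k * (C (q.coeff N) * X ^ (N - d) * g) := by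
        rw [hq₁]; ring
      rw [this] at h
      linear_combination h

/-- The part of `g` of degree at most `d`. -/
noncomputable def lowPart {R : Type*} [CommRing R] (g : R[X]) (d : ℕ) : R[X] :=
  ∑ i ∈ Finset.range (d + 1), monomial i (g.coeff i)

lemma coeff_lowPart {R : Type*} [CommRing R] (g : R[X]) (d i : ℕ) :
    (lowPart g d).coeff i = if i ≤ d then g.coeff i else 0 := by
  simp [lowPart, coeff_monomial]

lemma natDegree_lowPart_le {R : Type*} [CommRing R] (g : R[X]) (d : ℕ) :
    (lowPart g d).natDegree ≤ d := by
  rw [natDegree_le_iff_coeff_eq_zero]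
  intro i hi
  rw [coeff_lowPart, if_neg (by omega)]

lemma map_lowPart {R : Type*} [CommRing R] (g : R[X]) {d : ℕ} (x : R →+* ℝ)
    (h : (g.map x).natDegree ≤ d) : (lowPart g d).map x = g.map x := by
  ext i
  rw [coeff_map, coeff_lowPart]
  split_ifs with hi
  · rw [coeff_map]
  · rw [coeff_eq_zero_of_natDegree_lt (by omega : (g.map x).natDegree < i), map_zero]

variable {R : Type*} [CommRing R]

/-- The points `x`, `y` give every element of `Q` the same sign. -/
def SignEq (Q : Finset R) (x y : R →+* ℝ) : Prop :=
  ∀ r ∈ Q, SignType.sign (x r) = SignType.sign (y r)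

/-- Over `x` and `y`, the elements of `Q` have the same signs at all pairs of points fitting `f`. -/
def Adapted (f : Finset (ℝ × ℝ)) (Q : Finset R[X]) (x y : R →+* ℝ) : Prop :=
  ∀ t s, Fits f t s → ∀ q ∈ Q,
    SignType.sign ((q.map x).eval t) = SignType.sign ((q.map y).eval s)

/-- The sign diagram of `Q` depends only on the signs of finitely many elements of `R`. -/
def Eliminable (Q : Finset R[X]) : Prop :=
  ∃ Q' : Finset R, ∀ x y : R →+* ℝ, SignEq Q' x y → ∃ f, IsMatching f ∧ Adapted f Q x y

lemma Eliminable.mono {Q₁ Q₂ : Finset R[X]} (h : Eliminable Q₂) (hsub : Q₁ ⊆ Q₂) :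
    Eliminable Q₁ := by
  obtain ⟨Q', h⟩ := h
  refine ⟨Q', fun x y hxy => ?_⟩
  obtain ⟨f, hf, hfQ⟩ := h x y hxy
  exact ⟨f, hf, fun t s hts q hq => hfQ t s hts q (hsub hq)⟩

/-- The coefficients of `g` have the same signs at `x` and `y`. -/
def CoeffSignEq (g : R[X]) (x y : R →+* ℝ) : Prop :=
  ∀ i, SignType.sign (x (g.coeff i)) = SignType.sign (y (g.coeff i))

lemma SignEq.coeffSignEq {Q : Finset R} {x y : R →+* ℝ} (h : SignEq Q x y) {g : R[X]}
    (hg : g.coeffs ⊆ Q) : CoeffSignEq g x y := by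
  intro i
  by_cases hi : g.coeff i = 0
  · simp [hi]
  · exact h _ (hg (coeff_mem_coeffs hi))

lemma CoeffSignEq.coeff_eq_zero_iff {g : R[X]} {x y : R →+* ℝ} (h : CoeffSignEq g x y) (i : ℕ) :
    (g.map x).coeff i = 0 ↔ (g.map y).coeff i = 0 := by
  rw [coeff_map, coeff_map, ← sign_eq_zero_iff, h i, sign_eq_zero_iff]

lemma CoeffSignEq.map_eq_zero_iff {g : R[X]} {x y : R →+* ℝ} (h : CoeffSignEq g x y) :
    g.map x = 0 ↔ g.map y = 0 := by
  simp only [Polynomial.ext_iff, coeff_zero, h.coeff_eq_zero_iff]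

lemma CoeffSignEq.natDegree_eq {g : R[X]} {x y : R →+* ℝ} (h : CoeffSignEq g x y) :
    (g.map x).natDegree = (g.map y).natDegree := by
  have hle : ∀ n, (g.map x).natDegree ≤ n ↔ (g.map y).natDegree ≤ n := fun n => by
    simp only [natDegree_le_iff_coeff_eq_zero, h.coeff_eq_zero_iff]
  exact le_antisymm ((hle _).2 le_rfl) ((hle _).1 le_rfl)

lemma exists_fst_eq_of_isRoot {f : Finset (ℝ × ℝ)} {a b : ℝ[X]}
    (hsgn : ∀ t s, Fits f t s → SignType.sign (a.eval t) = SignType.sign (b.eval s))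
    (ha : a ≠ 0) {u v : ℝ} (huv : Fits f u v) (hu : a.eval u = 0) : (u, v) ∈ f := by
  by_contra hcon
  have hne : ∀ p ∈ f, p.1 ≠ u := fun p hp h => hcon <| by
    rwa [← h, ← (huv p hp).eq_iff.1 h]
  have hnhds : ∀ᶠ w in nhds u, Fits f w v := by
    refine (Filter.eventually_all_finset f).2 fun p hp => ?_
    have hp' := huv p hp
    rcases lt_or_gt_of_ne (hne p hp) with h | h
    · filter_upwards [eventually_gt_nhds h] with w hw
      have := hp'.1.1 h
      constructor <;> constructor <;> intro <;> grind
    · filter_upwards [eventually_lt_nhds h] with w hw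
      have := hp'.2.1 h
      constructor <;> constructor <;> intro <;> grind
  refine ha (eq_zero_of_infinite_isRoot a ((infinite_of_mem_nhds u hnhds).mono fun w hw => ?_))
  have h1 := hsgn w v hw
  rw [← hsgn u v huv, hu, sign_zero, sign_eq_zero_iff] at h1
  exact h1

lemma exists_root_of_sign_ne (a : ℝ[X]) {s t : ℝ}
    (h : SignType.sign (a.eval s) ≠ SignType.sign (a.eval t)) :
    ∃ v ∈ Set.uIcc s t, a.eval v = 0 := by
  have h0 : (0 : ℝ) ∈ Set.uIcc (a.eval s) (a.eval t) := by
    by_contra hcon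
    rw [Set.mem_uIcc, not_or] at hcon
    apply h
    rcases lt_or_ge 0 (a.eval s) with h1 | h1
    · rw [sign_pos h1, sign_pos]
      grind
    · have h2 : a.eval t < 0 := by grind
      have h3 : a.eval s < 0 := by grind
      rw [sign_neg h2, sign_neg h3]
  obtain ⟨v, hv, hv0⟩ := intermediate_value_uIcc a.continuous.continuousOn h0
  exact ⟨v, hv, hv0⟩

/-- A matching adapted to `Q` can be restricted to the roots of the elements of `Q`. -/
lemma Adapted.exists_restrict {f : Finset (ℝ × ℝ)} {Q : Finset R[X]} {x y : R →+* ℝ}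
    (hf : IsMatching f) (hfQ : Adapted f Q x y) (hxy : ∀ g ∈ Q, CoeffSignEq g x y) :
    ∃ f', f' ⊆ f ∧ Adapted f' Q x y ∧
      (∀ p ∈ f', ∃ g ∈ Q, g.map x ≠ 0 ∧ (g.map x).eval p.1 = 0) ∧
      (∀ g ∈ Q, g.map x ≠ 0 → ∀ u, (g.map x).eval u = 0 → ∃ v, (u, v) ∈ f') ∧
      ∀ g ∈ Q, g.map x ≠ 0 → ∀ v, (g.map y).eval v = 0 → ∃ u, (u, v) ∈ f' := by
  classical
  set f' := f.filter fun p => ∃ g ∈ Q, g.map x ≠ 0 ∧ (g.map x).eval p.1 = 0 with hf'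
  have hmem : ∀ g ∈ Q, g.map x ≠ 0 → ∀ u v, Fits f u v → (g.map x).eval u = 0 → (u, v) ∈ f' := by
    intro g hg hg0 u v huv hu
    refine Finset.mem_filter.2 ⟨?_, g, hg, hg0, hu⟩
    exact exists_fst_eq_of_isRoot (fun t s hts => hfQ t s hts g hg) hg0 huv hu
  have hroot : ∀ g ∈ Q, ∀ u v, Fits f u v → (g.map y).eval v = 0 → (g.map x).eval u = 0 := by
    intro g hg u v huv hv
    have := hfQ u v huv g hg
    rwa [hv, sign_zero, sign_eq_zero_iff] at this
  refine ⟨f', Finset.filter_subset _ _, ?_, fun p hp => (Finset.mem_filter.1 hp).2, ?_, ?_⟩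
  · intro t s hts g hg
    by_cases hg0 : g.map x = 0
    · rw [hg0, (hxy g hg).map_eq_zero_iff.1 hg0]
      simp
    obtain ⟨s', hs'⟩ := hf.exists_fits t
    rw [hfQ t s' hs' g hg]
    by_contra hcon
    obtain ⟨v, hv, hv0⟩ := exists_root_of_sign_ne _ hcon
    obtain ⟨u, huv⟩ := hf.exists_fits' v
    have hmem' := hmem g hg hg0 u v huv (hroot g hg u v huv hv0)
    have h1 : SameSide u t v s := hts _ hmem'
    have h2 : SameSide u t v s' := hs' _ (Finset.mem_of_mem_filter _ hmem')
    have h3 : SameSide v s v s' := h1.symm.trans h2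
    by_cases hvs : v = s
    · exact hcon (by rw [← hvs, ← h3.eq_iff.1 hvs])
    · have h4 := h3.1
      have h5 := h3.2
      rcases Set.mem_uIcc.1 hv with h | h <;> grind
  · intro g hg hg0 u hu
    obtain ⟨v, huv⟩ := hf.exists_fits u
    exact ⟨v, hmem g hg hg0 u v huv hu⟩
  · intro g hg hg0 v hv
    obtain ⟨u, huv⟩ := hf.exists_fits' v
    exact ⟨u, hmem g hg hg0 u v huv (hroot g hg u v huv hv)⟩

lemma exists_derivative_root_between {a : ℝ[X]} {u u' : ℝ} (hu : a.eval u = 0)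
    (hu' : a.eval u' = 0) (h : u < u') : ∃ w, u < w ∧ w < u' ∧ a.derivative.eval w = 0 := by
  obtain ⟨w, hw, hw0⟩ := exists_deriv_eq_zero h a.continuous.continuousOn (hu.trans hu'.symm)
  exact ⟨w, hw.1, hw.2, by rwa [Polynomial.deriv] at hw0⟩

/-- A matching adapted to polynomials including the derivative of `q` extends to one adapted to `q`,
as soon as the signs of `q` at the points of the matching agree. -/
lemma Adapted.exists_extend {f : Finset (ℝ × ℝ)} {Q : Finset R[X]} {x y : R →+* ℝ} {q : R[X]}
    (hf : IsMatching f) (hfQ : Adapted f Q x y) (hder : derivative q ∈ Q)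
    (hq : CoeffSignEq q x y)
    (hx : (derivative q).map x ≠ 0 → ∀ u, ((derivative q).map x).eval u = 0 → ∃ v, (u, v) ∈ f)
    (hy : (derivative q).map x ≠ 0 → ∀ v, ((derivative q).map y).eval v = 0 → ∃ u, (u, v) ∈ f)
    (hsgn : ∀ p ∈ f, SignType.sign ((q.map x).eval p.1) = SignType.sign ((q.map y).eval p.2)) :
    ∃ f', f ⊆ f' ∧ IsMatching f' ∧
      ∀ t s, Fits f' t s → SignType.sign ((q.map x).eval t) = SignType.sign ((q.map y).eval s) := by
  classical
  by_cases hd0 : (derivative q).map x = 0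
  · refine ⟨f, subset_rfl, hf, fun t s _ => ?_⟩
    have hx0 : (q.map x).natDegree = 0 :=
      derivative_eq_zero.1 (by rwa [derivative_map])
    have hy0 : (q.map y).natDegree = 0 := hq.natDegree_eq ▸ hx0
    rw [eq_C_of_natDegree_eq_zero hx0, eq_C_of_natDegree_eq_zero hy0, eval_C, eval_C, coeff_map,
      coeff_map, hq 0]
  set a := q.map x with ha
  set b := q.map y with hb
  have hda : (derivative q).map x = derivative a := (derivative_map q x).symm
  have hdb : (derivative q).map y = derivative b := (derivative_map q y).symm
  rw [hda] at hx
  rw [hda, hdb] at hy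
  rw [hda] at hd0
  have hxd := hx hd0
  have hyd := hy hd0
  have ha0 : a ≠ 0 := fun h => hd0 (by rw [h, derivative_zero])
  have hb0 : b ≠ 0 := fun h => ha0 (hq.map_eq_zero_iff.2 h)
  set f' := f ∪ (a.roots.toFinset ×ˢ b.roots.toFinset).filter fun p => Fits f p.1 p.2 with hf'
  have hnew : ∀ u v, (u, v) ∈ f' →
      (u, v) ∈ f ∨ (a.eval u = 0 ∧ b.eval v = 0 ∧ Fits f u v) := by
    intro u v h
    simp only [hf', Finset.mem_union, Finset.mem_filter, Finset.mem_product, Multiset.mem_toFinset,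
      mem_roots ha0, mem_roots hb0, IsRoot.def] at h
    tauto
  have hnew' : ∀ u v, Fits f u v → a.eval u = 0 → b.eval v = 0 → (u, v) ∈ f' := by
    intro u v h1 h2 h3
    simp only [hf', Finset.mem_union, Finset.mem_filter, Finset.mem_product, Multiset.mem_toFinset,
      mem_roots ha0, mem_roots hb0, IsRoot.def]
    tauto
  have hflip : ∀ {c t d s : ℝ}, SameSide c t d s → SameSide t c s d := fun h => ⟨h.2, h.1⟩
  have hltx : ∀ u v u' v', Fits f u v → Fits f u' v' → a.eval u = 0 → a.eval u' = 0 →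
      u < u' → v < v' := by
    intro u v u' v' h1 h2 h3 h4 h5
    obtain ⟨w, hw1, hw2, hw0⟩ := exists_derivative_root_between h3 h4 h5
    obtain ⟨z, hz⟩ := hxd w hw0
    exact ((h1 _ hz).2.1 hw1).trans ((h2 _ hz).1.1 hw2)
  have hlty : ∀ u v u' v', Fits f u v → Fits f u' v' → b.eval v = 0 → b.eval v' = 0 →
      v < v' → u < u' := by
    intro u v u' v' h1 h2 h3 h4 h5
    obtain ⟨w, hw1, hw2, hw0⟩ := exists_derivative_root_between h3 h4 h5
    obtain ⟨z, hz⟩ := hyd w hw0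
    exact ((h1 _ hz).2.2 hw1).trans ((h2 _ hz).1.2 hw2)
  refine ⟨f', Finset.subset_union_left, ?_, ?_⟩
  · rintro ⟨u, v⟩ hp ⟨u', v'⟩ hp'
    rcases hnew u v hp with h | ⟨h1, h2, h3⟩
    · rcases hnew u' v' hp' with h' | ⟨h1', h2', h3'⟩
      · exact hf _ h _ h'
      · exact h3' _ h
    · rcases hnew u' v' hp' with h' | ⟨h1', h2', h3'⟩
      · exact hflip (h3 _ h')
      · exact ⟨⟨hltx u v u' v' h3 h3' h1 h1', hlty u v u' v' h3 h3' h2 h2'⟩,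
          ⟨hltx u' v' u v h3' h3 h1' h1, hlty u' v' u v h3' h3 h2' h2⟩⟩
  · intro t s hts
    have hts' : Fits f t s := fun p hp => hts p (Finset.mem_union_left _ hp)
    by_cases hne : ∃ p ∈ f, p.1 = t
    · obtain ⟨p, hp, rfl⟩ := hne
      rw [hsgn p hp, (hts' p hp).eq_iff.1 rfl]
    push Not at hne
    have hdsgn : ∀ t s, Fits f t s →
        SignType.sign (a.derivative.eval t) = SignType.sign (b.derivative.eval s) := by
      intro t s h
      rw [← hda, ← hdb]
      exact hfQ t s h _ hder
    refine sign_eval_eq_of_monotone hts' hne (ε := SignType.sign (a.derivative.eval t)) ?_ ?_ ?_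
      hsgn hf ?_
    · rw [Ne, sign_eq_zero_iff]
      intro h
      obtain ⟨v, hv⟩ := hxd t h
      exact hne _ hv rfl
    · intro u hu
      rw [hdsgn t s hts', hdsgn u s fun p hp => (hu p hp).symm.trans (hts' p hp)]
    · intro v hv
      rw [hdsgn t v fun p hp => (hts' p hp).trans (hv p hp)]
    · intro u v huv h1 h2
      exact hts _ (hnew' u v huv h1 h2)

/-- The inductive step of the Cohen–Hörmander elimination procedure. -/
lemma Eliminable.insert_of_pseudo_remainder [DecidableEq R[X]] {Q₁ Q₂ : Finset R[X]} {q : R[X]}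
    (h : Eliminable Q₁)
    (hsub : Q₂ ⊆ Q₁) (hder : derivative q ∈ Q₂)
    (hrem : ∀ g ∈ Q₂, ∀ d, 1 ≤ d → d ≤ g.natDegree → ∃ (k : ℕ) (s r : R[X]), r ∈ Q₁ ∧
      C (g.coeff d) ^ k * q = lowPart g d * s + r) :
    Eliminable (insert q Q₂) := by
  classical
  obtain ⟨Q', h⟩ := h
  refine ⟨Q' ∪ (insert q Q₂).biUnion fun g => g.coeffs, fun x y hxy => ?_⟩
  have hcoeff : ∀ g ∈ insert q Q₂, CoeffSignEq g x y := fun g hg =>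
    hxy.coeffSignEq ((Finset.subset_biUnion_of_mem (fun g : R[X] => g.coeffs) hg).trans
      Finset.subset_union_right)
  obtain ⟨f₁, hf₁, hfQ₁⟩ := h x y fun r hr => hxy r (Finset.mem_union_left _ hr)
  obtain ⟨f, hff, hfQ, hfr, hfx, hfy⟩ := Adapted.exists_restrict (Q := Q₂) hf₁
    (fun t s hts q hq => hfQ₁ t s hts q (hsub hq))
    (fun g hg => hcoeff g (Finset.mem_insert_of_mem hg))
  have hf : IsMatching f := fun p hp q hq => hf₁ p (hff hp) q (hff hq)
  have hsgn : ∀ p ∈ f, SignType.sign ((q.map x).eval p.1) = SignType.sign ((q.map y).eval p.2) := by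
    intro p hp
    obtain ⟨g, hg, hg0, hgp⟩ := hfr p hp
    have hgc := hcoeff g (Finset.mem_insert_of_mem hg)
    have hgp' : (g.map y).eval p.2 = 0 := by
      have := hfQ _ _ (fun r hr => hf r hr p hp) g hg
      rwa [hgp, sign_zero, eq_comm, sign_eq_zero_iff] at this
    set d := (g.map x).natDegree with hd
    have hd1 : 1 ≤ d := by
      by_contra hcon
      have h0 : (g.map x).natDegree = 0 := by omega
      rw [eq_C_of_natDegree_eq_zero h0, eval_C] at hgp
      apply hg0
      rw [eq_C_of_natDegree_eq_zero h0, hgp, C_0]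
    obtain ⟨k, s, r, hr, heq⟩ := hrem g hg d hd1 natDegree_map_le
    have hxe : x (g.coeff d) ^ k * (q.map x).eval p.1 = (r.map x).eval p.1 := by
      have := congrArg (fun w => (w.map x).eval p.1) heq
      simpa [map_lowPart g x le_rfl, ← hd, map_lowPart g x hd.symm.le, hgp] using this
    have hye : y (g.coeff d) ^ k * (q.map y).eval p.2 = (r.map y).eval p.2 := by
      have := congrArg (fun w => (w.map y).eval p.2) heq
      simpa [map_lowPart g y (hgc.natDegree_eq ▸ hd.symm.le), hgp'] using this
    have hrs := hfQ₁ _ _ (fun r hr => hf₁ r hr p (hff hp)) r hr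
    rw [← hxe, ← hye, sign_mul, sign_mul, sign_pow, sign_pow, hgc d] at hrs
    refine mul_left_cancel₀ (pow_ne_zero k ?_) hrs
    rw [← hgc d, sign_ne_zero, ← coeff_map]
    exact leadingCoeff_ne_zero.2 hg0
  obtain ⟨f', hsub', hf', hq⟩ := Adapted.exists_extend hf hfQ hder
    (hcoeff q (Finset.mem_insert_self _ _)) (hfx _ hder) (hfy _ hder) hsgn
  refine ⟨f', hf', fun t s hts g hg => ?_⟩
  rcases Finset.mem_insert.1 hg with rfl | hg
  · exact hq t s hts
  · exact hfQ t s (fun p hp => hts p (hsub' hp)) g hg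

lemma eliminable_of_natDegree_le (D : ℕ) :
    ∀ A : Finset R[X], (∀ q ∈ A, q.natDegree ≤ D) → Eliminable A := by
  classical
  induction D with
  | zero =>
    intro A hA
    refine ⟨A.biUnion fun g => g.coeffs, fun x y hxy => ⟨∅, by simp [IsMatching], ?_⟩⟩
    intro t s _ q hq
    rw [eq_C_of_natDegree_le_zero (hA q hq), map_C, map_C, eval_C, eval_C]
    exact hxy.coeffSignEq (Finset.subset_biUnion_of_mem (fun g : R[X] => g.coeffs) hq) 0
  | succ D ih =>
    have key : ∀ E : Finset R[X], (∀ q ∈ E, q.natDegree ≤ D + 1) → ∀ B : Finset R[X],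
        (∀ q ∈ B, q.natDegree ≤ D) → Eliminable (B ∪ E) := by
      intro E
      induction E using Finset.induction_on with
      | empty =>
        intro _ B hB
        simpa using ih B hB
      | insert q E _ ihE =>
        intro hE B hB
        have hq : q.natDegree ≤ D + 1 := hE q (Finset.mem_insert_self _ _)
        have hE' : ∀ q ∈ E, q.natDegree ≤ D + 1 := fun g hg => hE g (Finset.mem_insert_of_mem hg)
        have hdq : (derivative q).natDegree ≤ D := (natDegree_derivative_le q).trans (by omega)
        set Q₂ := insert (derivative q) (B ∪ E) with hQ₂
        have hdeg : ∀ g ∈ Q₂, g.natDegree ≤ D + 1 := by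
          intro g hg
          simp only [hQ₂, Finset.mem_insert, Finset.mem_union] at hg
          rcases hg with rfl | hg | hg
          · omega
          · exact (hB g hg).trans (by omega)
          · exact hE' g hg
        have hrem : ∀ (g : R[X]) (d : ℕ), ∃ r : R[X], 1 ≤ d → r.natDegree < d ∧
            ∃ (k : ℕ) (s : R[X]), C (g.coeff d) ^ k * q = lowPart g d * s + r := by
          intro g d
          by_cases hd : 1 ≤ d
          · obtain ⟨k, s, r, h, hr⟩ :=
              exists_pseudo_remainder (lowPart g d) q (natDegree_lowPart_le g d) hd
            rw [coeff_lowPart, if_pos le_rfl] at h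
            exact ⟨r, fun _ => ⟨hr, k, s, h⟩⟩
          · exact ⟨0, fun h => absurd h hd⟩
        choose r hr using hrem
        set P := (Q₂ ×ˢ Finset.Icc 1 (D + 1)).image fun z => r z.1 z.2 with hP
        have hQ₁ : Eliminable ((insert (derivative q) (B ∪ P)) ∪ E) := by
          refine ihE hE' _ fun g hg => ?_
          simp only [Finset.mem_insert, Finset.mem_union] at hg
          rcases hg with rfl | hg | hg
          · exact hdq
          · exact hB g hg
          · obtain ⟨⟨g', d⟩, hz, rfl⟩ := Finset.mem_image.1 hg
            rw [Finset.mem_product, Finset.mem_Icc] at hz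
            have := (hr g' d hz.2.1).1
            have := hz.2.2
            simp only at *
            omega
        refine (hQ₁.insert_of_pseudo_remainder (q := q) (Q₂ := Q₂) ?_ ?_ ?_).mono ?_
        · intro g hg
          simp only [hQ₂, Finset.mem_insert, Finset.mem_union] at hg ⊢
          tauto
        · exact Finset.mem_insert_self _ _
        · intro g hg d hd1 hd2
          obtain ⟨-, k, s, h⟩ := hr g d hd1
          refine ⟨k, s, r g d, ?_, h⟩
          have : r g d ∈ P := Finset.mem_image.2 ⟨(g, d), Finset.mem_product.2
            ⟨hg, Finset.mem_Icc.2 ⟨hd1, hd2.trans (hdeg g hg)⟩⟩, rfl⟩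
          simp only [Finset.mem_insert, Finset.mem_union]
          tauto
        · intro g hg
          simp only [hQ₂, Finset.mem_insert, Finset.mem_union] at hg ⊢
          tauto
    intro A hA
    simpa using key A hA ∅ (by simp)

/-- The sign diagram of finitely many polynomials over `R` depends only on the signs of finitely
many elements of `R`. -/
theorem exists_signEq_forall_exists (Q : Finset R[X]) :
    ∃ Q' : Finset R, ∀ x y : R →+* ℝ, SignEq Q' x y → ∀ t : ℝ, ∃ s : ℝ, ∀ q ∈ Q,
      SignType.sign ((q.map x).eval t) = SignType.sign ((q.map y).eval s) := by
  obtain ⟨Q', h⟩ := eliminable_of_natDegree_le (Q.sup natDegree) Q fun q hq =>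
    Finset.le_sup (f := natDegree) hq
  refine ⟨Q', fun x y hxy t => ?_⟩
  obtain ⟨f, hf, hfQ⟩ := h x y hxy
  obtain ⟨s, hs⟩ := hf.exists_fits t
  exact ⟨s, hfQ t s hs⟩

lemma eval₂_option {τ : Type*} (x : R →+* ℝ) (w : Option τ → ℝ) (q : MvPolynomial (Option τ) R) :
    MvPolynomial.eval₂ x w q = ((MvPolynomial.optionEquivLeft R τ q).map
      (MvPolynomial.eval₂Hom x fun i => w (some i))).eval (w none) := by
  induction q using MvPolynomial.induction_on with
  | C r => simp [MvPolynomial.optionEquivLeft_C]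
  | add p q hp hq => simp [MvPolynomial.eval₂_add, hp, hq]
  | mul_X p i hp =>
    cases i <;> simp [MvPolynomial.eval₂_mul, hp, MvPolynomial.optionEquivLeft_X_none,
      MvPolynomial.optionEquivLeft_X_some]

/-- **Tarski–Seidenberg**: the sign vectors attained by finitely many polynomials over `R` depend
only on the signs of finitely many elements of `R`. -/
theorem exists_signEq_forall_exists_mvPolynomial (σ : Type) [Finite σ] :
    ∀ {R : Type} [CommRing R] (Q : Finset (MvPolynomial σ R)),
    ∃ Q' : Finset R, ∀ x y : R →+* ℝ, SignEq Q' x y → ∀ u : σ → ℝ, ∃ v : σ → ℝ, ∀ q ∈ Q,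
      SignType.sign (MvPolynomial.eval₂ x u q) = SignType.sign (MvPolynomial.eval₂ y v q) := by
  classical
  induction σ using Finite.induction_empty_option with
  | of_equiv e ih =>
    intro R _ Q
    obtain ⟨Q', h⟩ := ih (Q.image (MvPolynomial.rename e.symm))
    refine ⟨Q', fun x y hxy u => ?_⟩
    obtain ⟨v, hv⟩ := h x y hxy (u ∘ e)
    refine ⟨v ∘ e.symm, fun q hq => ?_⟩
    have := hv _ (Finset.mem_image_of_mem _ hq)
    simpa [MvPolynomial.eval₂_rename, Function.comp_assoc] using this
  | h_empty =>
    intro R _ Q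
    refine ⟨Q.image (MvPolynomial.coeff 0), fun x y hxy u => ⟨u, fun q hq => ?_⟩⟩
    rw [MvPolynomial.eq_C_of_isEmpty q, MvPolynomial.eval₂_C, MvPolynomial.eval₂_C]
    exact hxy _ (Finset.mem_image_of_mem _ hq)
  | h_option ih =>
    intro R _ Q
    obtain ⟨Q₁, h₁⟩ := exists_signEq_forall_exists (Q.image (MvPolynomial.optionEquivLeft R _))
    obtain ⟨Q', h⟩ := ih Q₁
    refine ⟨Q', fun x y hxy u => ?_⟩
    obtain ⟨v, hv⟩ := h x y hxy (fun i => u (some i))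
    obtain ⟨s, hs⟩ := h₁ (MvPolynomial.eval₂Hom x fun i => u (some i)) (MvPolynomial.eval₂Hom y v)
      hv (u none)
    refine ⟨fun o => o.elim s v, fun q hq => ?_⟩
    rw [eval₂_option, eval₂_option]
    exact hs _ (Finset.mem_image_of_mem _ hq)

end elimination

lemma isSemialgebraic_of_sign {σ : Type} [Fintype σ] {A : Set (σ → ℝ)}
    (Q : Finset (MvPolynomial σ ℝ))
    (h : ∀ x y : σ → ℝ, (∀ r ∈ Q, SignType.sign (MvPolynomial.eval x r) =
      SignType.sign (MvPolynomial.eval y r)) → x ∈ A → y ∈ A) :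
    IsSemialgebraic A := by
  classical
  let E := {ε : Q → SignType // ∃ x ∈ A, ∀ r : Q, SignType.sign (MvPolynomial.eval x r.1) = ε r}
  let e := (Fintype.equivFin E).symm
  refine ⟨Fintype.card E,
    fun i => ∑ r : Q, if (e i).1 r = 0 then r.1 ^ 2 else 0,
    fun i => Finset.univ.image fun r : Q =>
      if (e i).1 r = 0 then 1 else MvPolynomial.C (((e i).1 r : SignType) : ℝ) * r.1, ?_⟩
  have key : ∀ (ε : Q → SignType) (x : σ → ℝ),
      (MvPolynomial.eval x (∑ r : Q, if ε r = 0 then r.1 ^ 2 else 0) = 0 ∧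
        ∀ s ∈ Finset.univ.image (fun r : Q =>
          if ε r = 0 then 1 else MvPolynomial.C ((ε r : SignType) : ℝ) * r.1),
          0 < MvPolynomial.eval x s) ↔
      ∀ r : Q, SignType.sign (MvPolynomial.eval x r.1) = ε r := by
    intro ε x
    rw [map_sum, Finset.sum_eq_zero_iff_of_nonneg]
    · simp only [Finset.mem_univ, true_imp_iff, Finset.mem_image, true_and, forall_exists_index,
        forall_apply_eq_imp_iff]
      rw [← forall_and]
      refine forall_congr' fun r => ?_
      cases hr : ε r
      · simp [SignType.zero_eq_zero, sign_eq_zero_iff]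
      · simp [SignType.neg_eq_neg_one, sign_eq_neg_one_iff]
      · simp [SignType.pos_eq_one, sign_eq_one_iff]
    · intro r _
      split_ifs
      · rw [map_pow]
        positivity
      · simp
  ext x
  simp only [Set.mem_iUnion, Set.mem_ofPred_eq, key]
  constructor
  · intro hx
    refine ⟨e.symm ⟨fun r => SignType.sign (MvPolynomial.eval x r.1), x, hx, fun _ => rfl⟩, ?_⟩
    simp
  · rintro ⟨i, hi⟩
    obtain ⟨y, hy, hyi⟩ := (e i).2
    exact h y x (fun r hr => (hyi ⟨r, hr⟩).trans (hi ⟨r, hr⟩).symm) hy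

section compactGroup

open MvPolynomial MeasureTheory

variable {σ : Type*} {G : Type*} [TopologicalSpace G]

/-- Averaging a polynomial over a closed subgroup `K` of a compact group with polynomial
multiplication. -/
lemma exists_eval_eq_integral [Group G] (c : G → σ → ℝ) (hc : Continuous c)
    (M : σ → MvPolynomial σ (MvPolynomial σ ℝ))
    (hM : ∀ g h s, c (g * h) s = eval₂ (eval (c h)) (c g) (M s))
    (K : Subgroup G) [MeasurableSpace K] [BorelSpace K] [CompactSpace K] (μ : Measure K)
    [IsFiniteMeasure μ]
    (P : MvPolynomial σ ℝ) :
    ∃ A : MvPolynomial σ ℝ, ∀ g, eval (c g) A = ∫ k : K, eval (c (g * k)) P ∂μ := by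
  set P₂ := aeval M P with hP₂
  have hP₂e : ∀ g h, eval (c (g * h)) P = eval₂ (eval (c h)) (c g) P₂ := by
    intro g h
    have : (fun s => c (g * h) s) = fun s => eval₂ (eval (c h)) (c g) (M s) :=
      funext fun s => hM g h s
    rw [show c (g * h) = fun s => eval₂ (eval (c h)) (c g) (M s) from this, hP₂]
    induction P using MvPolynomial.induction_on with
    | C r => simp [MvPolynomial.algebraMap_eq, IsScalarTower.algebraMap_apply ℝ (MvPolynomial σ ℝ)]
    | add p q hp hq => simp only [map_add, eval₂_add, hp, hq]
    | mul_X p i hp => simp only [map_mul, eval₂_mul, hp, eval_X, aeval_X]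
  refine ⟨∑ m ∈ P₂.support, monomial m (∫ k : K, eval (c k) (coeff m P₂) ∂μ), fun g => ?_⟩
  simp_rw [hP₂e, eval₂_eq, map_sum, eval_monomial]
  rw [integral_finsetSum]
  · refine Finset.sum_congr rfl fun m _ => ?_
    rw [integral_mul_const]
    rfl
  · intro m _
    refine (Continuous.integrable_of_hasCompactSupport ?_ (HasCompactSupport.of_compactSpace _))
    exact (((coeff m P₂).continuous_eval.comp (hc.comp continuous_subtype_val))).mul
      continuous_const

lemma exists_polynomial_near [CompactSpace G] (c : G → σ → ℝ) (hc : Continuous c)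
    (hinj : Function.Injective c)
    (f : C(G, ℝ)) {ε : ℝ} (hε : 0 < ε) :
    ∃ P : MvPolynomial σ ℝ, ∀ g, |eval (c g) P - f g| < ε := by
  set cc : σ → C(G, ℝ) := fun s => ⟨fun g => c g s, (continuous_apply s).comp hc⟩
  have heval : ∀ (P : MvPolynomial σ ℝ) g, (aeval cc P) g = eval (c g) P := by
    intro P g
    induction P using MvPolynomial.induction_on with
    | C r => simp
    | add p q hp hq => simp [hp, hq]
    | mul_X p i hp => simp [hp, cc]
  have hsep : (aeval (R := ℝ) cc).range.SeparatesPoints := by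
    intro g h hgh
    obtain ⟨s, hs⟩ := Function.ne_iff.1 (hinj.ne hgh)
    exact ⟨cc s, ⟨cc s, ⟨X s, by simp⟩, rfl⟩, hs⟩
  obtain ⟨⟨_, P, rfl⟩, hP⟩ :=
    ContinuousMap.exists_mem_subalgebra_near_continuousMap_of_separatesPoints _ hsep f ε hε
  refine ⟨P, fun g => ?_⟩
  have := (ContinuousMap.norm_coe_le_norm (aeval cc P - f) g).trans_lt hP
  rwa [ContinuousMap.sub_apply, heval, Real.norm_eq_abs] at this

/-- A closed subgroup of a compact group with polynomial multiplication is separated from every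
other point of the group by a polynomial. -/
lemma exists_polynomial_separating [Group G] [IsTopologicalGroup G] [CompactSpace G] [T2Space G]
    (c : G → σ → ℝ) (hc : Continuous c)
    (hinj : Function.Injective c)
    (M : σ → MvPolynomial σ (MvPolynomial σ ℝ))
    (hM : ∀ g h s, c (g * h) s = eval₂ (eval (c h)) (c g) (M s))
    (K : Subgroup G) (hK : IsClosed (K : Set G)) {g : G} (hg : g ∉ K) :
    ∃ P : MvPolynomial σ ℝ, (∀ h ∈ K, eval (c h) P = 0) ∧ eval (c g) P ≠ 0 := by
  have hgK : IsClosed ((g * ·) '' (K : Set G)) := (Homeomorph.mulLeft g).isClosed_image.2 hK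
  have hdisj : Disjoint (K : Set G) ((g * ·) '' (K : Set G)) := by
    rw [Set.disjoint_left]
    rintro _ h1 ⟨k, hk, rfl⟩
    exact hg ((K.mul_mem_cancel_right hk).1 h1)
  obtain ⟨f, hf0, hf1, -⟩ := exists_continuous_zero_one_of_isClosed hK hgK hdisj
  obtain ⟨P, hP⟩ := exists_polynomial_near c hc hinj f (show (0 : ℝ) < 1 / 4 by norm_num)
  have : CompactSpace K := isCompact_iff_compactSpace.1 hK.isCompact
  let _ : MeasurableSpace K := borel K
  have : BorelSpace K := ⟨rfl⟩
  let μ : Measure K := Measure.haarMeasure ⊤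
  have : IsProbabilityMeasure μ := ⟨by
    simpa using Measure.haarMeasure_self (K₀ := (⊤ : TopologicalSpace.PositiveCompacts K))⟩
  obtain ⟨A, hA⟩ := exists_eval_eq_integral c hc M hM K μ P
  have hAK : ∀ h ∈ K, eval (c h) A = eval (c 1) A := by
    intro h hh
    rw [hA, hA]
    have := integral_mul_left_eq_self (μ := μ) (fun k : K => eval (c k) P) ⟨h, hh⟩
    simpa using this
  have hA1 : |eval (c 1) A| ≤ 1 / 4 := by
    rw [hA]
    have := norm_integral_le_of_norm_le_const (μ := μ) (f := fun k : K => eval (c (1 * k)) P)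
      (C := 1 / 4) (Filter.Eventually.of_forall fun k => by
        have h1 := hP k
        have h2 : f k = 0 := hf0 k.2
        rw [h2, sub_zero] at h1
        simpa using h1.le)
    simpa using this
  have hAg : |eval (c g) A - 1| ≤ 1 / 4 := by
    rw [hA]
    have hint : Integrable (fun k : K => eval (c (g * k)) P) μ :=
      Continuous.integrable_of_hasCompactSupport
        (P.continuous_eval.comp (hc.comp (continuous_const.mul continuous_subtype_val)))
        (HasCompactSupport.of_compactSpace _)
    have := norm_integral_le_of_norm_le_const (μ := μ) (f := fun k : K => eval (c (g * k)) P - 1)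
      (C := 1 / 4) (Filter.Eventually.of_forall fun k => by
        have h1 := hP (g * k)
        have h2 : f (g * k) = 1 := hf1 ⟨k, k.2, rfl⟩
        rw [h2] at h1
        exact h1.le)
    rw [integral_sub hint (integrable_const _)] at this
    simpa using this
  refine ⟨A - C (eval (c 1) A), fun h hh => by simp [hAK h hh], fun h => ?_⟩
  rw [map_sub, eval_C, sub_eq_zero] at h
  rw [abs_le] at hA1 hAg
  linarith [hA1.2, hAg.1]

/-- A closed subgroup of a compact algebraic group is algebraic. -/
lemma exists_finset_zeros_eq_subgroup [Finite σ] [Group G] [IsTopologicalGroup G]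
    [CompactSpace G] [T2Space G] (c : G → σ → ℝ) (hc : Continuous c)
    (hinj : Function.Injective c)
    (M : σ → MvPolynomial σ (MvPolynomial σ ℝ))
    (hM : ∀ g h s, c (g * h) s = eval₂ (eval (c h)) (c g) (M s))
    (hrange : ∀ Y, (∀ P : MvPolynomial σ ℝ, (∀ g, eval (c g) P = 0) → eval Y P = 0) →
      Y ∈ Set.range c)
    (K : Subgroup G) (hK : IsClosed (K : Set G)) :
    ∃ S : Finset (MvPolynomial σ ℝ), ∀ Y, (∀ P ∈ S, eval Y P = 0) ↔ ∃ h ∈ K, c h = Y := by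
  set I : Ideal (MvPolynomial σ ℝ) := ⨅ h : K, RingHom.ker (eval (c h)) with hI
  have hmem : ∀ P, P ∈ I ↔ ∀ h ∈ K, eval (c h) P = 0 := fun P => by
    simp [hI, RingHom.mem_ker]
  obtain ⟨S, hS⟩ : I.FG := IsNoetherian.noetherian I
  refine ⟨S, fun Y => ⟨fun hY => ?_, ?_⟩⟩
  · have hle : I ≤ RingHom.ker (eval Y) := by
      rw [← hS, Ideal.span_le]
      exact fun P hP => hY P hP
    have hYI : ∀ P, (∀ h ∈ K, eval (c h) P = 0) → eval Y P = 0 := fun P hP =>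
      hle ((hmem P).2 hP)
    obtain ⟨g, rfl⟩ := hrange Y fun P hP => hYI P fun h _ => hP h
    refine ⟨g, ?_, rfl⟩
    by_contra hg
    obtain ⟨P, hP, hPg⟩ := exists_polynomial_separating c hc hinj M hM K hK hg
    exact hPg (hYI P hP)
  · rintro ⟨h, hh, rfl⟩ P hP
    have : P ∈ I := hS ▸ Ideal.subset_span hP
    exact (hmem P).1 this h hh

end compactGroup

/-- Tarski–Seidenberg for images of algebraic sets under polynomial maps. -/
lemma isSemialgebraic_image_zeros {σ τ : Type} [Fintype σ] [Fintype τ]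
    (S : Finset (MvPolynomial σ ℝ)) (F : τ → MvPolynomial σ ℝ) :
    IsSemialgebraic {x : τ → ℝ | ∃ u : σ → ℝ, (∀ P ∈ S, MvPolynomial.eval u P = 0) ∧
      ∀ t, MvPolynomial.eval u (F t) = x t} := by
  classical
  let ι : MvPolynomial σ ℝ →+* MvPolynomial σ (MvPolynomial τ ℝ) :=
    MvPolynomial.map MvPolynomial.C
  obtain ⟨Q', hQ'⟩ := exists_signEq_forall_exists_mvPolynomial σ
    (S.image ι ∪ Finset.univ.image fun t => MvPolynomial.C (MvPolynomial.X t) - ι (F t))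
  have hι : ∀ (x : τ → ℝ) (u : σ → ℝ) (P : MvPolynomial σ ℝ),
      MvPolynomial.eval₂ (MvPolynomial.eval x) u (ι P) = MvPolynomial.eval u P := by
    intro x u P
    have : (MvPolynomial.eval x).comp MvPolynomial.C = RingHom.id ℝ := by ext; simp
    rw [MvPolynomial.eval₂_map, this, MvPolynomial.eval₂_id]
  refine isSemialgebraic_of_sign Q' fun x y hxy => ?_
  rintro ⟨u, hu, hux⟩
  obtain ⟨v, hv⟩ := hQ' (MvPolynomial.eval x) (MvPolynomial.eval y) hxy u
  refine ⟨v, fun P hP => ?_, fun t => ?_⟩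
  · have := hv (ι P) (Finset.mem_union_left _ (Finset.mem_image_of_mem _ hP))
    rw [hι, hι, hu P hP, sign_zero] at this
    exact sign_eq_zero_iff.1 this.symm
  · have := hv _ (Finset.mem_union_right _ (Finset.mem_image_of_mem
      (fun t => MvPolynomial.C (MvPolynomial.X t) - ι (F t)) (Finset.mem_univ t)))
    rw [MvPolynomial.eval₂_sub, MvPolynomial.eval₂_sub, hι, hι, MvPolynomial.eval₂_C,
      MvPolynomial.eval₂_C, MvPolynomial.eval_X, MvPolynomial.eval_X, hux, sub_self,
      sign_zero] at this
    exact (sub_eq_zero.1 (sign_eq_zero_iff.1 this.symm)).symm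

lemma Matrix.mem_unitary_iff_transpose_mul_self {n : Type*} [Fintype n] [DecidableEq n]
    {A : Matrix n n ℝ} : A ∈ unitary (Matrix n n ℝ) ↔ Aᵀ * A = 1 := by
  rw [Unitary.mem_iff, Matrix.star_eq_conjTranspose,
    Matrix.conjTranspose_eq_transpose_of_trivial]
  exact ⟨fun h => h.1, fun h => ⟨h, mul_eq_one_comm.1 h⟩⟩

instance Matrix.compactSpace_unitary {n : Type*} [Fintype n] [DecidableEq n] :
    CompactSpace (unitary (Matrix n n ℝ)) := by
  refine isCompact_iff_compactSpace.1 ?_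
  have hK : IsCompact (Set.univ.pi fun _ : n => Set.univ.pi fun _ : n => Set.Icc (-1 : ℝ) 1) :=
    isCompact_univ_pi fun _ => isCompact_univ_pi fun _ => isCompact_Icc
  refine hK.of_isClosed_subset (isClosed_unitary (R := Matrix n n ℝ)) fun U hU i _ j _ => ?_
  exact abs_le.1 (entry_norm_bound_of_unitary hU i j)

section closedSubgroup

open MvPolynomial

variable {ι n : Type} [Fintype ι] [Fintype n] [DecidableEq n]

/-- A closed subgroup of a product of orthogonal groups is the zero set of finitely many
polynomials in the entries. -/
lemma exists_finset_zeros_eq_closed_subgroup_unitary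
    (K : Subgroup (ι → unitary (Matrix n n ℝ))) (hK : IsClosed (K : Set (ι → unitary (Matrix n n ℝ)))) :
    ∃ S : Finset (MvPolynomial (ι × n × n) ℝ), ∀ Y, (∀ P ∈ S, eval Y P = 0) ↔
      ∃ h ∈ K, (fun z : ι × n × n => (h z.1 : Matrix n n ℝ) z.2.1 z.2.2) = Y := by
  refine exists_finset_zeros_eq_subgroup
    (fun (g : ι → unitary (Matrix n n ℝ)) (z : ι × n × n) => (g z.1 : Matrix n n ℝ) z.2.1 z.2.2)
    ?_ ?_ (fun z => ∑ j, X (z.1, z.2.1, j) * C (X (z.1, j, z.2.2))) ?_ ?_ K hK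
  · exact continuous_pi fun z => (continuous_subtype_val.comp (continuous_apply z.1)).matrix_elem
      z.2.1 z.2.2
  · intro g h hgh
    funext i
    ext a b
    exact congrFun hgh (i, a, b)
  · intro g h s
    simp [eval₂_sum, Matrix.mul_apply]
  · intro Y hY
    refine ⟨fun i => ⟨Matrix.of fun a b => Y (i, a, b),
      Matrix.mem_unitary_iff_transpose_mul_self.2 ?_⟩, rfl⟩
    ext a b
    have := hY (∑ j, X (i, j, a) * X (i, j, b) - C ((1 : Matrix n n ℝ) a b)) fun g => by
      have h := congrFun₂ (Matrix.mem_unitary_iff_transpose_mul_self.1 (g i).2) a b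
      simpa [Matrix.mul_apply, sub_eq_zero] using h
    simpa [Matrix.mul_apply, sub_eq_zero] using this

end closedSubgroup

/-- For a morphism `φ` into the orthogonal matrices, words `w₁, …, w_k` and a
linear set `R = {v₀ + λ₁v₁ + ⋯ + λ_p v_p}` of exponent vectors, the closure of the image under
`φ` of the bounded linear language `L = {w₁^{n₁} ⋯ w_k^{n_k} : (n₁, …, n_k) ∈ R}` is
semialgebraic. -/
theorem closure_image_linear_language_semialgebraic {m n k p : ℕ}
    (φ : FreeMonoid (Fin m) →* Matrix (Fin n) (Fin n) ℝ)
    (hφ : ∀ u, (φ u)ᵀ * φ u = 1)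
    (w : Fin k → FreeMonoid (Fin m)) (v₀ : Fin k → ℕ) (v : Fin p → Fin k → ℕ) :
    MatSemialgebraic (closure (φ ''
      {x : FreeMonoid (Fin m) | ∃ lam : Fin p → ℕ,
        x = (List.ofFn fun i => w i ^ (v₀ i + ∑ t, lam t * v t i)).prod})) := by
  let U : Fin k → unitary (Matrix (Fin n) (Fin n) ℝ) := fun i =>
    ⟨φ (w i), Matrix.mem_unitary_iff_transpose_mul_self.2 (hφ _)⟩
  let S₀ : Submonoid (Fin k → unitary (Matrix (Fin n) (Fin n) ℝ)) :=
    { carrier := {g | ∃ lam : Fin p → ℕ, g = fun i => U i ^ ∑ t, lam t * v t i}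
      one_mem' := ⟨0, by ext; simp⟩
      mul_mem' := by
        rintro _ _ ⟨a, rfl⟩ ⟨b, rfl⟩
        refine ⟨a + b, funext fun i => ?_⟩
        simp [add_mul, Finset.sum_add_distrib, pow_add] }
  let K : Subgroup (Fin k → unitary (Matrix (Fin n) (Fin n) ℝ)) :=
    (Subgroup.closure (S₀ : Set (Fin k → _))).topologicalClosure
  have hKS : closure (S₀ : Set (Fin k → unitary (Matrix (Fin n) (Fin n) ℝ))) = K := by
    rw [Subgroup.topologicalClosure_coe, ← closure_submonoidClosure_eq_closure_subgroupClosure,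
      Submonoid.closure_eq]
  let F : (Fin k → unitary (Matrix (Fin n) (Fin n) ℝ)) → Matrix (Fin n) (Fin n) ℝ :=
    fun g => (List.ofFn fun i => φ (w i) ^ v₀ i * (g i : Matrix (Fin n) (Fin n) ℝ)).prod
  have hF : Continuous F := by
    simp only [F, List.ofFn_eq_map]
    exact continuous_list_prod _ fun i _ => by fun_prop
  have himage : closure (φ '' {x : FreeMonoid (Fin m) | ∃ lam : Fin p → ℕ,
        x = (List.ofFn fun i => w i ^ (v₀ i + ∑ t, lam t * v t i)).prod}) =
      F '' (K : Set (Fin k → unitary (Matrix (Fin n) (Fin n) ℝ))) := by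
    rw [← hKS, image_closure_of_isCompact isClosed_closure.isCompact hF.continuousOn]
    congr 1
    ext M
    constructor
    · rintro ⟨_, ⟨lam, rfl⟩, rfl⟩
      refine ⟨_, ⟨lam, rfl⟩, ?_⟩
      simp [F, U, map_list_prod, List.map_ofFn, pow_add, Function.comp_def]
    · rintro ⟨_, ⟨lam, rfl⟩, rfl⟩
      refine ⟨_, ⟨lam, rfl⟩, ?_⟩
      simp [F, U, map_list_prod, List.map_ofFn, pow_add, Function.comp_def]
  obtain ⟨S, hS⟩ := exists_finset_zeros_eq_closed_subgroup_unitary K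
    (Subgroup.isClosed_topologicalClosure _)
  let F' : Matrix (Fin n) (Fin n) (MvPolynomial (Fin k × Fin n × Fin n) ℝ) :=
    (List.ofFn fun i => MvPolynomial.C.mapMatrix (φ (w i) ^ v₀ i) *
      Matrix.of fun a b => MvPolynomial.X (i, a, b)).prod
  have hF' : ∀ g : Fin k → unitary (Matrix (Fin n) (Fin n) ℝ),
      (MvPolynomial.eval fun z : Fin k × Fin n × Fin n =>
        (g z.1 : Matrix (Fin n) (Fin n) ℝ) z.2.1 z.2.2).mapMatrix F' = F g := by
    intro g
    rw [map_list_prod, List.map_ofFn]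
    congr 2
    funext i
    rw [Function.comp_apply, map_mul]
    congr 1
    · ext a b
      simp
    · ext a b
      simp
  have := isSemialgebraic_image_zeros S fun t : Fin n × Fin n => F' t.1 t.2
  rw [himage, MatSemialgebraic]
  convert this using 1
  ext x
  simp only [Set.mem_ofPred_eq]
  constructor
  · rintro ⟨h, hh, hx⟩
    refine ⟨_, (hS _).2 ⟨h, hh, rfl⟩, fun t => ?_⟩
    exact congrFun₂ ((hF' h).trans hx) t.1 t.2
  · rintro ⟨u, hu, hux⟩
    obtain ⟨h, hh, rfl⟩ := (hS u).1 hu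
    refine ⟨h, hh, ?_⟩
    rw [← hF' h]
    ext a b
    exact hux (a, b)
end
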